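/- For all nonnegative integers n, N(0,7;7n+5) = N(1,7;7n+5) = N(2,7;7n+5) = N(3,7;7n+5). -/

import Mathlib

/-- The number of partitions of `n`. -/
noncomputable def partitionFn (n : ℕ) : ℕ := Fintype.card (Nat.Partition n)

/-- The rank of a partition: largest part minus number of parts. -/
def partitionRank {n : ℕ} (P : n.Partition) : ℤ :=
  (P.parts.sup : ℤ) - P.parts.card

/-- `N a b n`: number of partitions of `n` whose rank is congruent to `a` mod `b`. -/
noncomputable def rankCount (a b : ℤ) (n : ℕ) : ℕ :=
  Fintype.card {P : n.Partition // partitionRank P % b = a % b}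

open Filter Topology

/-- The theta function `∑ (-1)^n q^(n(n-1)/2) z^n` with `q = s^2`. -/
noncomputable def jac (s z : ℂ) : ℂ := ∑' n : ℤ, (-1) ^ n * s ^ (n * (n - 1)) * z ^ n

theorem zpow_split {s : ℂ} (hs : s ≠ 0) {a b c : ℤ} (h : a = b + c) :
    s ^ a = s ^ b * s ^ c := by
  rw [h, zpow_add₀ hs]

theorem neg_one_zpow_add (a b : ℤ) : (-1 : ℂ) ^ (a + b) = (-1) ^ a * (-1) ^ b :=
  zpow_add₀ (by norm_num) a b

theorem neg_one_zpow_succ (n : ℤ) : (-1 : ℂ) ^ (n + 1) = -(-1) ^ n := by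
  rw [neg_one_zpow_add]; simp

theorem neg_one_zpow_two_mul (n : ℤ) : (-1 : ℂ) ^ (2 * n) = 1 := by
  rw [zpow_mul]; simp

theorem neg_one_zpow_neg (n : ℤ) : (-1 : ℂ) ^ (-n) = (-1) ^ n := by
  rw [zpow_neg, ← inv_zpow]; norm_num

theorem norm_neg_one_zpow (n : ℤ) : ‖(-1 : ℂ) ^ n‖ = 1 := by simp [norm_zpow]

theorem summable_gauss {t r : ℝ} (ht : 0 < t) (ht1 : t < 1) (hr : 0 < r) :
    Summable fun n : ℤ => t ^ (n * n) * r ^ n := by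
  have key : ∀ r : ℝ, 0 < r → Summable fun n : ℕ => t ^ (n * n) * r ^ n := by
    intro r hr
    refine summable_of_ratio_test_tendsto_lt_one zero_lt_one ?_ (l := 0) ?_
    · exact Eventually.of_forall fun n => by positivity
    · have : (fun n : ℕ => ‖t ^ ((n + 1) * (n + 1)) * r ^ (n + 1)‖ / ‖t ^ (n * n) * r ^ n‖)
          = fun n => (t * r) * (t ^ 2) ^ n := by
        funext n
        rw [Real.norm_of_nonneg (by positivity), Real.norm_of_nonneg (by positivity),
          div_eq_iff (by positivity)]
        ring
      rw [this]
      have h2 : t ^ 2 < 1 := by nlinarith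
      simpa using (tendsto_pow_atTop_nhds_zero_of_lt_one (by positivity) h2).const_mul (t * r)
  refine Summable.of_nat_of_neg ?_ ?_
  · refine (key r hr).congr fun n => ?_
    rw [zpow_natCast, ← Nat.cast_mul, zpow_natCast]
  · refine (key r⁻¹ (by positivity)).congr fun n => ?_
    rw [zpow_neg, zpow_natCast, inv_pow, neg_mul_neg, ← Nat.cast_mul, zpow_natCast]

theorem zpow_le_add_zpow {a b x : ℝ} (ha : 0 < a) (hax : a ≤ x) (hxb : x ≤ b) (n : ℤ) :
    x ^ n ≤ a ^ n + b ^ n := by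
  have hx : 0 < x := ha.trans_le hax
  have hb : 0 < b := hx.trans_le hxb
  rcases le_total 0 n with hn | hn
  · have := zpow_le_zpow_left₀ hn hx.le hxb
    have := zpow_pos ha n
    linarith
  · have h1 : x ^ n ≤ a ^ n := by
      obtain ⟨m, rfl⟩ : ∃ m : ℕ, n = -m := ⟨n.natAbs, by omega⟩
      rw [zpow_neg, zpow_neg, zpow_natCast, zpow_natCast]
      gcongr
    have := zpow_pos hb n
    linarith

theorem norm_jac_term {s : ℂ} (hs : s ≠ 0) (z : ℂ) (n : ℤ) :
    ‖(-1) ^ n * s ^ (n * (n - 1)) * z ^ n‖ = ‖s‖ ^ (n * n) * (‖z‖ / ‖s‖) ^ n := by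
  rw [norm_mul, norm_mul, norm_neg_one_zpow, norm_zpow, norm_zpow, one_mul, mul_sub, mul_one,
    zpow_sub₀ (norm_ne_zero_iff.2 hs), div_zpow]
  ring

theorem summable_norm_jac {s z : ℂ} (hs : s ≠ 0) (hs1 : ‖s‖ < 1) (hz : z ≠ 0) :
    Summable fun n : ℤ => ‖(-1) ^ n * s ^ (n * (n - 1)) * z ^ n‖ := by
  simp_rw [norm_jac_term hs]
  have := norm_pos_iff.2 hs
  have := norm_pos_iff.2 hz
  exact summable_gauss ‹_› hs1 (by positivity)

theorem jac_sq_mul {s : ℂ} (hs : s ≠ 0) {z : ℂ} (hz : z ≠ 0) :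
    jac s (s ^ 2 * z) = -z⁻¹ * jac s z := by
  unfold jac
  rw [← tsum_mul_left, ← (Equiv.addRight (1 : ℤ)).tsum_eq
    (fun n : ℤ => -z⁻¹ * ((-1) ^ n * s ^ (n * (n - 1)) * z ^ n))]
  refine tsum_congr fun n => ?_
  simp only [Equiv.coe_addRight]
  rw [neg_one_zpow_succ, mul_zpow, zpow_add_one₀ hz,
    zpow_split hs (show (n + 1) * (n + 1 - 1) = n * (n - 1) + 2 * n by ring), zpow_mul s 2 n]
  field_simp

theorem jac_inv {s z : ℂ} (hz : z ≠ 0) : jac s z⁻¹ = -z⁻¹ * jac s z := by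
  unfold jac
  rw [← tsum_mul_left, ← (Equiv.subLeft (1 : ℤ)).tsum_eq
    (fun n : ℤ => -z⁻¹ * ((-1) ^ n * s ^ (n * (n - 1)) * z ^ n))]
  refine tsum_congr fun n => ?_
  simp only [Equiv.subLeft_apply]
  have h1 : (-1 : ℂ) ^ (1 - n) = -(-1) ^ n := by
    rw [sub_eq_add_neg, neg_one_zpow_add, neg_one_zpow_neg]; simp
  have h2 : z ^ (1 - n) = z * (z ^ n)⁻¹ := by rw [zpow_sub₀ hz, zpow_one, div_eq_mul_inv]
  rw [show (1 - n) * (1 - n - 1) = n * (n - 1) by ring, h1, h2, inv_zpow]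
  field_simp

theorem jac_one (s : ℂ) : jac s 1 = 0 := by
  have := jac_inv (s := s) (z := 1) one_ne_zero
  simp only [inv_one, neg_mul, one_mul] at this
  exact self_eq_neg.1 this

theorem jac_mul_zpow {s : ℂ} (hs : s ≠ 0) {z : ℂ} (hz : z ≠ 0) (n : ℤ) :
    jac s (z * s ^ (2 * n)) = (-1) ^ n * (s ^ (n * (n - 1)))⁻¹ * (z ^ n)⁻¹ * jac s z := by
  have step : ∀ n : ℤ, jac s (z * s ^ (2 * (n + 1))) =
      -(z * s ^ (2 * n))⁻¹ * jac s (z * s ^ (2 * n)) := by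
    intro n
    rw [← jac_sq_mul hs (mul_ne_zero hz (zpow_ne_zero _ hs)), mul_add, mul_one, zpow_add₀ hs]
    congr 1
    norm_cast
    ring
  have coef : ∀ n : ℤ, (-1 : ℂ) ^ (n + 1) * (s ^ ((n + 1) * (n + 1 - 1)))⁻¹ * (z ^ (n + 1))⁻¹ =
      -(z * s ^ (2 * n))⁻¹ * ((-1) ^ n * (s ^ (n * (n - 1)))⁻¹ * (z ^ n)⁻¹) := by
    intro n
    rw [neg_one_zpow_succ, zpow_add_one₀ hz,
      zpow_split hs (show (n + 1) * (n + 1 - 1) = n * (n - 1) + 2 * n by ring), mul_inv, mul_inv,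
      mul_inv]
    ring
  induction n using Int.induction_on with
  | zero => simp
  | succ n ih => rw [step, coef, ih]; ring
  | pred n ih =>
    have h1 := step (-n - 1)
    have h2 := coef (-n - 1)
    rw [sub_add_cancel] at h1 h2
    rw [h1, h2, mul_assoc] at ih
    exact mul_left_cancel₀ (neg_ne_zero.2 (inv_ne_zero
      (mul_ne_zero hz (zpow_ne_zero _ hs)))) ih

theorem jac_zpow {s : ℂ} (hs : s ≠ 0) (n : ℤ) : jac s (s ^ (2 * n)) = 0 := by
  have := jac_mul_zpow hs one_ne_zero n
  rwa [one_mul, jac_one, mul_zero] at this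

theorem half_ball_bounds {z₀ z : ℂ} (hz : z ∈ Metric.ball z₀ (‖z₀‖ / 2)) :
    ‖z₀‖ / 2 ≤ ‖z‖ ∧ ‖z‖ ≤ 2 * ‖z₀‖ := by
  rw [Metric.mem_ball, dist_eq_norm] at hz
  have h1 := norm_sub_norm_le z z₀
  have h2 := norm_sub_norm_le z₀ z
  rw [norm_sub_rev] at h2
  have := norm_nonneg z₀
  constructor <;> linarith

theorem differentiableAt_zpow_ne {z : ℂ} (hz : z ≠ 0) (n : ℤ) :
    DifferentiableAt ℂ (fun w : ℂ => w ^ n) z :=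
  differentiableAt_zpow.2 (Or.inl hz)

theorem jac_differentiableOn {s z₀ : ℂ} (hs : s ≠ 0) (hs1 : ‖s‖ < 1) (hz : z₀ ≠ 0) :
    DifferentiableOn ℂ (jac s) (Metric.ball z₀ (‖z₀‖ / 2)) ∧
    HasSum (fun n : ℤ => (-1) ^ n * s ^ (n * (n - 1)) * (n * z₀ ^ (n - 1)))
      (deriv (jac s) z₀) := by
  have hz0 := norm_pos_iff.2 hz
  have hs0 := norm_pos_iff.2 hs
  have hsum := (summable_gauss hs0 hs1 (show 0 < ‖z₀‖ / 2 / ‖s‖ by positivity)).add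
    (summable_gauss hs0 hs1 (show 0 < 2 * ‖z₀‖ / ‖s‖ by positivity))
  have hd : ∀ n : ℤ, DifferentiableOn ℂ (fun z : ℂ => (-1) ^ n * s ^ (n * (n - 1)) * z ^ n)
      (Metric.ball z₀ (‖z₀‖ / 2)) := by
    intro n z hz
    have := (half_ball_bounds hz).1
    have hz' : z ≠ 0 := norm_pos_iff.1 (by linarith)
    exact ((differentiableAt_zpow_ne hz' n).const_mul _).differentiableWithinAt
  have hb : ∀ n : ℤ, ∀ z ∈ Metric.ball z₀ (‖z₀‖ / 2), ‖(-1) ^ n * s ^ (n * (n - 1)) * z ^ n‖ ≤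
      ‖s‖ ^ (n * n) * (‖z₀‖ / 2 / ‖s‖) ^ n + ‖s‖ ^ (n * n) * (2 * ‖z₀‖ / ‖s‖) ^ n := by
    intro n z hz
    obtain ⟨h1, h2⟩ := half_ball_bounds hz
    rw [norm_jac_term hs, ← mul_add]
    gcongr
    exact zpow_le_add_zpow (by positivity) (by gcongr) (by gcongr) n
  refine ⟨Complex.differentiableOn_tsum_of_summable_norm hsum hd Metric.isOpen_ball hb, ?_⟩
  refine (Complex.hasSum_deriv_of_summable_norm hsum hd Metric.isOpen_ball hb
    (Metric.mem_ball_self (by positivity))).congr_fun ?_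
  intro n
  rw [deriv_const_mul _ (differentiableAt_zpow_ne hz n), deriv_zpow]

theorem differentiableAt_jac {s z₀ : ℂ} (hs : s ≠ 0) (hs1 : ‖s‖ < 1) (hz : z₀ ≠ 0) :
    DifferentiableAt ℂ (jac s) z₀ :=
  (jac_differentiableOn hs hs1 hz).1.differentiableAt
    (Metric.ball_mem_nhds _ (by have := norm_pos_iff.2 hz; positivity))

/-- The derivative of the functional equation at a zero. -/
theorem deriv_jac_sq_mul {s z : ℂ} (hs : s ≠ 0) (hs1 : ‖s‖ < 1) (hz : z ≠ 0)
    (h0 : jac s z = 0) : s ^ 2 * deriv (jac s) (s ^ 2 * z) = -z⁻¹ * deriv (jac s) z := by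
  have hd := (differentiableAt_jac hs hs1 hz).hasDerivAt
  have hd2 := (differentiableAt_jac hs hs1 (mul_ne_zero (pow_ne_zero 2 hs) hz)).hasDerivAt
  have h1 : HasDerivAt (fun w => jac s (s ^ 2 * w)) (deriv (jac s) (s ^ 2 * z) * (s ^ 2 * 1)) z :=
    hd2.comp z ((hasDerivAt_id z).const_mul (s ^ 2))
  have h2 := ((hasDerivAt_inv hz).neg).mul hd
  have h3 : (fun w => jac s (s ^ 2 * w)) =ᶠ[𝓝 z] (-fun w => w⁻¹) * jac s := by
    filter_upwards [isOpen_ne.mem_nhds hz] with w hw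
    simpa using jac_sq_mul hs hw
  have h4 := (h1.congr_of_eventuallyEq h3.symm).unique h2
  rw [h0] at h4
  simp only [Pi.neg_apply, mul_zero, zero_add] at h4
  linear_combination h4

theorem tsum_int_mod (N : ℕ) [NeZero N] {f : ℤ → ℂ} (hf : Summable f) :
    ∑' n, f n = ∑ r ∈ Finset.range N, ∑' m : ℤ, f (N * m + r) := by
  rw [← (Int.divModEquiv N).symm.tsum_eq f,
    ← (Equiv.prodComm (Fin N) ℤ).tsum_eq]
  have hs : Summable fun p : Fin N × ℤ =>
      f ((Int.divModEquiv N).symm (Equiv.prodComm (Fin N) ℤ p)) :=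
    ((Int.divModEquiv N).symm.summable_iff.2 hf).comp_injective (Equiv.injective _)
  rw [hs.tsum_prod, tsum_fintype, Finset.sum_range]
  refine Finset.sum_congr rfl fun r _ => tsum_congr fun m => ?_
  simp [Int.divModEquiv, mul_comm]

theorem tsum_int_even_odd {f : ℤ → ℂ} (hf : Summable f) :
    ∑' n, f n = ∑' n : ℤ, f (2 * n) + ∑' n : ℤ, f (2 * n + 1) := by
  rw [tsum_int_mod 2 hf, Finset.sum_range_succ, Finset.sum_range_one]
  simp

theorem tsum_int_parity {f : ℤ → ℂ} (hf : Summable f) (l : ℤ) :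
    ∑' n, f n = ∑' n : ℤ, f (2 * n - l) + ∑' n : ℤ, f (l - 1 - 2 * n) := by
  rw [← (Equiv.subRight l).tsum_eq f]
  refine (tsum_int_even_odd ((Equiv.subRight l).summable_iff.2 hf)).trans ?_
  rw [← (Equiv.subLeft (l - 1)).tsum_eq (fun n : ℤ => (f ∘ Equiv.subRight l) (2 * n + 1))]
  congr 1
  refine tsum_congr fun n => ?_
  simp only [Function.comp, Equiv.subRight_apply, Equiv.subLeft_apply]
  congr 1
  ring

/-- The Cauchy product of two bilateral series along lines of slope `c`. -/
theorem tsum_mul_bilateral {f g : ℤ → ℂ} (hf : Summable fun n => ‖f n‖)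
    (hg : Summable fun n => ‖g n‖) (c d : ℤ) :
    Summable (fun k : ℤ => ∑' n : ℤ, f (k + c * n + d) * g n) ∧
      (∑' n, f n) * ∑' n, g n = ∑' k : ℤ, ∑' n : ℤ, f (k + c * n + d) * g n := by
  have hs := summable_mul_of_summable_norm hf hg
  let e : ℤ × ℤ ≃ ℤ × ℤ :=
    { toFun := fun p => (p.1 + c * p.2 + d, p.2)
      invFun := fun p => (p.1 - c * p.2 - d, p.2)
      left_inv := fun p => by ext <;> simp; ring
      right_inv := fun p => by ext <;> simp; ring }
  have hs' := e.summable_iff.2 hs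
  refine ⟨hs'.prod, ?_⟩
  rw [tsum_mul_tsum_of_summable_norm hf hg, ← e.tsum_eq]
  exact hs'.tsum_prod

/-- Euler's pentagonal series, with `q = s^2`. -/
noncomputable def pent (s : ℂ) : ℂ := ∑' n : ℤ, (-1) ^ n * s ^ (n * (3 * n + 1))

theorem summable_quad {s : ℂ} (hs : s ≠ 0) (hs1 : ‖s‖ < 1) {z : ℂ} (hz : z ≠ 0) (b c : ℤ)
    {a : ℤ} (ha : 0 < a) (e : ℤ → ℤ) (he : ∀ n, e n = a * (n * n) + b * n + c) :
    Summable fun n : ℤ => ‖s ^ e n * z ^ n‖ := by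
  have hs0 := norm_pos_iff.2 hs
  have hz0 := norm_pos_iff.2 hz
  have h := (summable_gauss (t := ‖s‖ ^ a) (r := ‖s‖ ^ b * ‖z‖) (by positivity)
    (zpow_lt_one₀ hs0 hs1 ha) (by positivity)).mul_left (‖s‖ ^ c)
  refine h.congr fun n => ?_
  rw [norm_mul, norm_zpow, norm_zpow, he, zpow_add₀ hs0.ne', zpow_add₀ hs0.ne', mul_zpow,
    ← zpow_mul, ← zpow_mul]
  ring

theorem summable_pent {s : ℂ} (hs : s ≠ 0) (hs1 : ‖s‖ < 1) :
    Summable fun n : ℤ => ‖(-1) ^ n * s ^ (n * (3 * n + 1))‖ := by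
  refine (summable_quad hs hs1 one_ne_zero 1 0 (show (0 : ℤ) < 3 by norm_num)
    (fun n => n * (3 * n + 1)) (fun n => by ring)).congr fun n => ?_
  rw [norm_mul, norm_mul, norm_neg_one_zpow]
  simp

theorem cube_zpow (z : ℂ) (n : ℤ) : (z ^ 3) ^ n = z ^ (3 * n) := by
  rw [zpow_mul]; norm_cast

theorem summable_quint {s z : ℂ} (hs : s ≠ 0) (hs1 : ‖s‖ < 1) (hz : z ≠ 0) :
    Summable (fun n : ℤ => ‖(-1) ^ n * s ^ (n * (3 * n - 1)) * z ^ (3 * n)‖) ∧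
    Summable (fun n : ℤ => ‖(-1) ^ n * s ^ (n * (3 * n + 1)) * z ^ (3 * n + 1)‖) := by
  constructor
  · refine (summable_quad hs hs1 (pow_ne_zero 3 hz) (-1) 0 (show (0 : ℤ) < 3 by norm_num)
      (fun n => n * (3 * n - 1)) (fun n => by ring)).congr fun n => ?_
    rw [norm_mul, norm_mul, norm_mul, norm_neg_one_zpow, one_mul, cube_zpow]
  · refine ((summable_quad hs hs1 (pow_ne_zero 3 hz) 1 0 (show (0 : ℤ) < 3 by norm_num)
      (fun n => n * (3 * n + 1)) (fun n => by ring)).mul_right ‖z‖).congr fun n => ?_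
    rw [norm_mul, norm_mul, norm_mul, norm_neg_one_zpow, one_mul, zpow_add_one₀ hz, cube_zpow,
      norm_mul]
    rw [mul_assoc]

/-- The quintuple product identity. -/
theorem quintuple {s z : ℂ} (hs : s ≠ 0) (hs1 : ‖s‖ < 1) (hz : z ≠ 0) :
    jac s z * ∑' n : ℤ, (-1) ^ n * s ^ (n * (3 * n - 1)) * z ^ (3 * n) * (1 + z * s ^ (2 * n)) =
      pent s * jac s (z ^ 2) := by
  obtain ⟨hq1, hq2⟩ := summable_quint hs hs1 hz
  have hj := summable_norm_jac hs hs1 hz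
  have split : ∑' n : ℤ, (-1) ^ n * s ^ (n * (3 * n - 1)) * z ^ (3 * n) * (1 + z * s ^ (2 * n)) =
      (∑' n : ℤ, (-1) ^ n * s ^ (n * (3 * n - 1)) * z ^ (3 * n)) +
        ∑' n : ℤ, (-1) ^ n * s ^ (n * (3 * n + 1)) * z ^ (3 * n + 1) := by
    rw [← Summable.tsum_add hq1.of_norm hq2.of_norm]
    refine tsum_congr fun n => ?_
    rw [zpow_split hs (show n * (3 * n + 1) = n * (3 * n - 1) + 2 * n by ring),
      zpow_add_one₀ hz]
    ring
  obtain ⟨hs1', h1⟩ := tsum_mul_bilateral hj hq1 (-3) 0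
  obtain ⟨hs2', h2⟩ := tsum_mul_bilateral hj hq2 (-3) (-1)
  rw [split, mul_add]
  unfold jac
  rw [h1, h2, ← Summable.tsum_add hs1' hs2']
  have c1 : ∀ k n : ℤ, (-1) ^ (k + -3 * n + 0) * s ^ ((k + -3 * n + 0) * (k + -3 * n + 0 - 1)) *
      z ^ (k + -3 * n + 0) * ((-1) ^ n * s ^ (n * (3 * n - 1)) * z ^ (3 * n)) =
      (-1) ^ k * z ^ k * s ^ (k * (k - 1) + 12 * n * n - 6 * n * k + 2 * n) := by
    intro k n
    have h1 : (-1 : ℂ) ^ k = (-1) ^ (k + -3 * n + 0) * (-1) ^ n := by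
      rw [← neg_one_zpow_add, show k + -3 * n + 0 + n = k + 2 * (-n) by ring,
          neg_one_zpow_add _ (2 * -n), neg_one_zpow_two_mul, mul_one]
    rw [zpow_split hs (show k * (k - 1) + 12 * n * n - 6 * n * k + 2 * n =
      (k + -3 * n + 0) * (k + -3 * n + 0 - 1) + n * (3 * n - 1) by ring), h1,
      zpow_split hz (show k = (k + -3 * n + 0) + 3 * n by ring)]
    ring
  have c2 : ∀ k n : ℤ, (-1) ^ (k + -3 * n + -1) *
      s ^ ((k + -3 * n + -1) * (k + -3 * n + -1 - 1)) *
      z ^ (k + -3 * n + -1) * ((-1) ^ n * s ^ (n * (3 * n + 1)) * z ^ (3 * n + 1)) =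
      -((-1) ^ k * z ^ k * s ^ (k * (k - 1) + 2 - 2 * k + 12 * n * n - 6 * n * k + 10 * n)) := by
    intro k n
    have h1 : (-1 : ℂ) ^ k = -((-1) ^ (k + -3 * n + -1) * (-1) ^ n) := by
      rw [← neg_one_zpow_add, ← neg_one_zpow_succ,
        show k + -3 * n + -1 + n + 1 = k + 2 * (-n) by ring,
          neg_one_zpow_add _ (2 * -n), neg_one_zpow_two_mul, mul_one]
    rw [zpow_split hs (show k * (k - 1) + 2 - 2 * k + 12 * n * n - 6 * n * k + 10 * n =
      (k + -3 * n + -1) * (k + -3 * n + -1 - 1) + n * (3 * n + 1) by ring), h1,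
      zpow_split hz (show k = (k + -3 * n + -1) + (3 * n + 1) by ring)]
    ring
  simp_rw [c1, c2, tsum_neg, tsum_mul_left]
  have hS : Summable fun k : ℤ =>
      (-1) ^ k * z ^ k * ∑' n : ℤ, s ^ (k * (k - 1) + 12 * n * n - 6 * n * k + 2 * n) +
      -((-1) ^ k * z ^ k *
        ∑' n : ℤ, s ^ (k * (k - 1) + 2 - 2 * k + 12 * n * n - 6 * n * k + 10 * n)) := by
    simp_rw [c1, tsum_mul_left] at hs1'
    simp_rw [c2, tsum_neg, tsum_mul_left] at hs2'
    exact hs1'.add hs2'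
  rw [tsum_int_even_odd hS, ← tsum_mul_left, ← add_zero (tsum fun n : ℤ => pent s * _)]
  congr 1
  · refine tsum_congr fun l => ?_
    have hp : (-1 : ℂ) ^ l * pent s =
      ∑' n : ℤ, s ^ (12 * n * n - 12 * n * l + 3 * l * l + 2 * n - l) -
      ∑' n : ℤ, s ^ (12 * n * n - 12 * n * l + 3 * l * l + 10 * n - 5 * l + 2) := by
      unfold pent
      rw [tsum_int_parity (summable_pent hs hs1).of_norm l, mul_add, ← tsum_mul_left,
        ← tsum_mul_left, sub_eq_add_neg (tsum _), ← tsum_neg]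
      congr 1
      · refine tsum_congr fun n => ?_
        rw [← mul_assoc, ← neg_one_zpow_add, show l + (2 * n - l) = 2 * n by ring,
          neg_one_zpow_two_mul, one_mul]
        congr 1
        ring
      · refine tsum_congr fun n => ?_
        rw [← mul_assoc, ← neg_one_zpow_add, show l + (l - 1 - 2 * n) = 2 * (l - n - 1) + 1 by ring,
          neg_one_zpow_succ, neg_one_zpow_two_mul, neg_one_mul]
        congr 2
        ring
    have hA : ∑' n : ℤ, s ^ (2 * l * (2 * l - 1) + 12 * n * n - 6 * n * (2 * l) + 2 * n) =
        s ^ (l * (l - 1)) * ∑' n : ℤ, s ^ (12 * n * n - 12 * n * l + 3 * l * l + 2 * n - l) := by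
      rw [← tsum_mul_left]
      refine tsum_congr fun n => ?_
      rw [← zpow_add₀ hs]
      congr 1
      ring
    have hB : ∑' n : ℤ, s ^ (2 * l * (2 * l - 1) + 2 - 2 * (2 * l) + 12 * n * n -
        6 * n * (2 * l) + 10 * n) = s ^ (l * (l - 1)) *
          ∑' n : ℤ, s ^ (12 * n * n - 12 * n * l + 3 * l * l + 10 * n - 5 * l + 2) := by
      rw [← tsum_mul_left]
      refine tsum_congr fun n => ?_
      rw [← zpow_add₀ hs]
      congr 1
      ring
    have hz2 : (z ^ 2) ^ l = z ^ (2 * l) := by rw [zpow_mul]; norm_cast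
    rw [hA, hB, neg_one_zpow_two_mul, hz2]
    linear_combination (-(s ^ (l * (l - 1)) * z ^ (2 * l))) * hp
  · convert tsum_zero with l
    rw [← (Equiv.subLeft l).tsum_eq (fun n : ℤ => s ^ ((2 * l + 1) * (2 * l + 1 - 1) + 2 -
      2 * (2 * l + 1) + 12 * n * n - 6 * n * (2 * l + 1) + 10 * n)), ← sub_eq_add_neg, sub_eq_zero]
    congr 2
    funext n
    simp only [Equiv.subLeft_apply]
    congr 1
    ring

/-- The two halves of the product `jac s (u * v) * jac s (u / v)`. -/
noncomputable def thetaEven (s u : ℂ) : ℂ := ∑' n : ℤ, s ^ (2 * n * n - 2 * n) * u ^ (2 * n)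

noncomputable def thetaOdd (s u : ℂ) : ℂ := ∑' n : ℤ, s ^ (2 * n * n) * u ^ (2 * n)

theorem jac_mul_jac_div {s u v : ℂ} (hs : s ≠ 0) (hs1 : ‖s‖ < 1) (hu : u ≠ 0) (hv : v ≠ 0) :
    jac s (u * v) * jac s (u / v) =
      thetaEven s u * thetaOdd s v - u / v * (thetaOdd s u * thetaEven s v) := by
  have h1 := summable_norm_jac hs hs1 (mul_ne_zero hu hv)
  have h2 := summable_norm_jac hs hs1 (div_ne_zero hu hv)
  obtain ⟨hS, h⟩ := tsum_mul_bilateral h1 h2 1 0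
  unfold jac
  rw [h, tsum_int_even_odd hS, sub_eq_add_neg]
  congr 1
  · unfold thetaOdd
    rw [← tsum_mul_left]
    refine tsum_congr fun b => ?_
    unfold thetaEven
    rw [← (Equiv.subRight b).tsum_eq, ← tsum_mul_right]
    refine tsum_congr fun a => ?_
    simp only [Equiv.subRight_apply]
    rw [show 2 * b + 1 * (a - b) + 0 = a + b by ring, mul_zpow, div_zpow,
      show (-1 : ℂ) ^ (a - b) = (-1) ^ (a + b) by
        rw [show a - b = a + b + 2 * (-b) by ring, neg_one_zpow_add, neg_one_zpow_two_mul, mul_one],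
      show ∀ x y z w k : ℂ, k * x * (y * z) * (k * w * (u ^ (a - b) / v ^ (a - b))) =
        (k * k) * (x * w) * (y * u ^ (a - b)) * (z / v ^ (a - b)) by intros; ring,
      ← neg_one_zpow_add, ← two_mul (a + b), neg_one_zpow_two_mul, ← zpow_add₀ hs, ← zpow_add₀ hu,
      ← zpow_sub₀ hv, zpow_split hs (show (a + b) * (a + b - 1) + (a - b) * (a - b - 1) =
        (2 * a * a - 2 * a) + 2 * b * b by ring), show a + b + (a - b) = 2 * a by ring,
      show a + b - (a - b) = 2 * b by ring]
    ring
  · have hE : thetaEven s v = ∑' b : ℤ, s ^ (2 * b * b + 2 * b) * v ^ (2 * b + 2) := by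
      unfold thetaEven
      rw [← (Equiv.addRight (1 : ℤ)).tsum_eq]
      refine tsum_congr fun b => ?_
      simp only [Equiv.coe_addRight]
      congr 2 <;> ring
    rw [hE, ← tsum_mul_left, ← tsum_mul_left, ← tsum_neg]
    refine tsum_congr fun b => ?_
    unfold thetaOdd
    rw [← (Equiv.subRight b).tsum_eq, ← tsum_mul_right, ← tsum_mul_left, ← tsum_neg]
    refine tsum_congr fun a => ?_
    simp only [Equiv.subRight_apply]
    rw [show 2 * b + 1 + 1 * (a - b) + 0 = a + b + 1 by ring, mul_zpow, div_zpow,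
      show (-1 : ℂ) ^ (a - b) = (-1) ^ (a + b) by
        rw [show a - b = a + b + 2 * (-b) by ring, neg_one_zpow_add, neg_one_zpow_two_mul, mul_one],
      neg_one_zpow_succ,
      show ∀ x y z w k : ℂ, -k * x * (y * z) * (k * w * (u ^ (a - b) / v ^ (a - b))) =
        -((k * k) * (x * w) * (y * u ^ (a - b)) * (z / v ^ (a - b))) by intros; ring,
      ← neg_one_zpow_add, ← two_mul (a + b), neg_one_zpow_two_mul, ← zpow_add₀ hs, ← zpow_add₀ hu,
      ← zpow_sub₀ hv, zpow_split hs (show (a + b + 1) * (a + b + 1 - 1) + (a - b) * (a - b - 1) =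
        (2 * a * a) + (2 * b * b + 2 * b) by ring),
      show a + b + 1 + (a - b) = 2 * a + 1 by ring,
      show a + b + 1 - (a - b) = 2 * b + 1 by ring, show 2 * b + 2 = 2 * b + 1 + 1 by ring,
      zpow_add_one₀ hu, zpow_add_one₀ hv (2 * b + 1)]
    field_simp

/-- `jac s (u * v) * jac s (u / v) / u` as an antisymmetric minor. -/
theorem weierstrass {s a b c d : ℂ} (hs : s ≠ 0) (hs1 : ‖s‖ < 1) (ha : a ≠ 0) (hb : b ≠ 0)
    (hc : c ≠ 0) (hd : d ≠ 0) :
    jac s (a * b) * jac s (a / b) / a * (jac s (c * d) * jac s (c / d) / c) -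
      jac s (a * c) * jac s (a / c) / a * (jac s (b * d) * jac s (b / d) / b) +
      jac s (a * d) * jac s (a / d) / a * (jac s (b * c) * jac s (b / c) / b) = 0 := by
  rw [jac_mul_jac_div hs hs1 ha hb, jac_mul_jac_div hs hs1 hc hd, jac_mul_jac_div hs hs1 ha hc,
    jac_mul_jac_div hs hs1 hb hd, jac_mul_jac_div hs hs1 ha hd, jac_mul_jac_div hs hs1 hb hc]
  field_simp
  ring

/-- A function on the punctured plane invariant under `z ↦ q z` is constant. -/
theorem eq_of_elliptic {q : ℂ} (hq : q ≠ 0) (hq1 : ‖q‖ < 1) {f : ℂ → ℂ}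
    (hf : ∀ z, z ≠ 0 → DifferentiableAt ℂ f z) (hfq : ∀ z, z ≠ 0 → f (q * z) = f z)
    {z w : ℂ} (hz : z ≠ 0) (hw : w ≠ 0) : f z = f w := by
  have hq0 := norm_pos_iff.2 hq
  have hzpow : ∀ (n : ℤ) z, z ≠ 0 → f (q ^ n * z) = f z := by
    intro n z hz
    induction n using Int.induction_on with
    | zero => simp
    | succ n ih =>
      rw [zpow_add_one₀ hq, mul_comm _ q, mul_assoc,
        hfq _ (mul_ne_zero (zpow_ne_zero _ hq) hz), ih]
    | pred n ih =>
      rw [← ih, ← hfq (q ^ (-(n : ℤ) - 1) * z) (mul_ne_zero (zpow_ne_zero _ hq) hz),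
        zpow_sub_one₀ hq]
      congr 1
      field_simp
  obtain ⟨C, hC⟩ : ∃ C, ∀ z ∈ Metric.closedBall (0 : ℂ) 1 \ Metric.ball 0 ‖q‖, ‖f z‖ ≤ C := by
    refine ((isCompact_closedBall (0 : ℂ) 1).diff
      Metric.isOpen_ball).exists_bound_of_continuousOn ?_
    intro z hz
    refine (hf z ?_).continuousAt.continuousWithinAt
    rintro rfl
    simp [hq] at hz
  have hbound : ∀ z, z ≠ 0 → ‖f z‖ ≤ C := by
    intro z hz
    have hz0 := norm_pos_iff.2 hz
    obtain ⟨n, hn1, hn2⟩ := exists_mem_Ico_zpow (x := ‖z‖) (y := ‖q‖⁻¹) hz0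
      ((one_lt_inv₀ hq0).2 hq1)
    rw [← hzpow (n + 1) z hz]
    have hp := zpow_pos hq0 (n + 1)
    have e1 : ‖q‖ ^ (n + 1) * ‖q‖⁻¹ ^ n = ‖q‖ := by
      rw [inv_zpow, zpow_add_one₀ hq0.ne']
      field_simp
    have e2 : ‖q‖ ^ (n + 1) * ‖q‖⁻¹ ^ (n + 1) = 1 := by
      rw [inv_zpow, mul_inv_cancel₀ hp.ne']
    refine hC _ ⟨?_, ?_⟩
    · rw [mem_closedBall_zero_iff, norm_mul, norm_zpow, ← e2]
      gcongr
    · rw [mem_ball_zero_iff, norm_mul, norm_zpow, not_lt]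
      calc ‖q‖ = ‖q‖ ^ (n + 1) * ‖q‖⁻¹ ^ n := e1.symm
        _ ≤ _ := by gcongr
  have hent : Differentiable ℂ fun u => f (Complex.exp u) := fun u =>
    (hf _ (Complex.exp_ne_zero u)).comp u Complex.differentiableAt_exp
  have := hent.apply_eq_apply_of_bounded (isBounded_iff_forall_norm_le.2 ⟨C, by
    rintro _ ⟨u, rfl⟩
    exact hbound _ (Complex.exp_ne_zero u)⟩) (Complex.log z) (Complex.log w)
  simpa [Complex.exp_log hz, Complex.exp_log hw] using this

/-- The quotient `jac s z / (1 - z * s ^ (2 * n))`, extended over its removable singularity. -/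
noncomputable def jacQuot (s : ℂ) (n : ℤ) (z : ℂ) : ℂ :=
  -s ^ (-(2 * n)) * dslope (jac s) (s ^ (-(2 * n))) z

theorem jac_neg_zpow {s : ℂ} (hs : s ≠ 0) (n : ℤ) : jac s (s ^ (-(2 * n))) = 0 := by
  rw [← mul_neg, jac_zpow hs]

theorem one_sub_mul_jacQuot {s : ℂ} (hs : s ≠ 0) (n : ℤ) (z : ℂ) :
    (1 - z * s ^ (2 * n)) * jacQuot s n z = jac s z := by
  have h := sub_smul_dslope (jac s) (s ^ (-(2 * n))) z
  rw [jac_neg_zpow hs, sub_zero, smul_eq_mul] at h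
  rw [← h, jacQuot, zpow_neg]
  have := zpow_ne_zero (2 * n) hs
  field_simp
  ring

theorem jacQuot_of_ne {s z : ℂ} (hs : s ≠ 0) {n : ℤ} (h : 1 - z * s ^ (2 * n) ≠ 0) :
    jacQuot s n z = jac s z / (1 - z * s ^ (2 * n)) := by
  rw [eq_div_iff h, mul_comm, one_sub_mul_jacQuot hs]

theorem jacQuot_pole (s : ℂ) (n : ℤ) :
    jacQuot s n (s ^ (-(2 * n))) = -s ^ (-(2 * n)) * deriv (jac s) (s ^ (-(2 * n))) := by
  rw [jacQuot, dslope_same]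

theorem eq_of_one_sub_eq_zero {s z : ℂ} {n : ℤ} (h : 1 - z * s ^ (2 * n) = 0) :
    z = s ^ (-(2 * n)) := by
  rw [zpow_neg]
  exact eq_inv_of_mul_eq_one_left (sub_eq_zero.1 h).symm

theorem differentiableAt_jacQuot {s z : ℂ} (hs : s ≠ 0) (hs1 : ‖s‖ < 1) (n : ℤ) (hz : z ≠ 0) :
    DifferentiableAt ℂ (jacQuot s n) z := by
  have hd : DifferentiableOn ℂ (jac s) {0}ᶜ := fun w hw =>
    (differentiableAt_jac hs hs1 hw).differentiableWithinAt
  have ho : ({0}ᶜ : Set ℂ) ∈ 𝓝 (s ^ (-(2 * n))) :=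
    isOpen_compl_singleton.mem_nhds (zpow_ne_zero _ hs)
  have := ((Complex.differentiableOn_dslope ho).2 hd).differentiableAt
    (isOpen_compl_singleton.mem_nhds hz)
  exact this.const_mul _

theorem jacQuot_sq_mul {s z : ℂ} (hs : s ≠ 0) (hs1 : ‖s‖ < 1) (hz : z ≠ 0) (n : ℤ) :
    jacQuot s n (s ^ 2 * z) = -z⁻¹ * jacQuot s (n + 1) z := by
  have e : s ^ 2 * z * s ^ (2 * n) = z * s ^ (2 * (n + 1)) := by
    rw [zpow_split hs (show 2 * (n + 1) = 2 + 2 * n by ring)]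
    norm_cast
    ring
  by_cases h : 1 - z * s ^ (2 * (n + 1)) = 0
  · have h1 := eq_of_one_sub_eq_zero h
    have h2 := eq_of_one_sub_eq_zero (e ▸ h)
    have j0 : jac s z = 0 := by rw [h1, jac_neg_zpow hs]
    have d := deriv_jac_sq_mul hs hs1 hz j0
    rw [h2, jacQuot_pole, ← h2]
    conv_rhs => rw [h1, jacQuot_pole, ← h1]
    have := zpow_ne_zero (2 * n) hs
    rw [show -z⁻¹ * (-z * deriv (jac s) z) = deriv (jac s) z by field_simp]
    rw [show -(s ^ 2 * z) * deriv (jac s) (s ^ 2 * z) =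
      -z * (s ^ 2 * deriv (jac s) (s ^ 2 * z)) by ring, d]
    field_simp
  · rw [jacQuot_of_ne hs h, jacQuot_of_ne hs (by rwa [e]), e, jac_sq_mul hs hz, mul_div_assoc]

theorem jacQuot_bounded {s : ℂ} (hs : s ≠ 0) (hs1 : ‖s‖ < 1) {z₀ : ℂ} (hz₀ : z₀ ≠ 0) :
    ∃ C, ∀ n : ℤ, ∀ z ∈ Metric.ball z₀ (‖z₀‖ / 2), ‖jacQuot s n z‖ ≤ C := by
  have hz0 := norm_pos_iff.2 hz₀
  have hs0 := norm_pos_iff.2 hs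
  set K := Metric.closedBall z₀ (‖z₀‖ / 2) with hK
  have hKc : IsCompact K := isCompact_closedBall _ _
  have hK0 : ∀ z ∈ K, z ≠ 0 := by
    rintro z hz rfl
    rw [hK, Metric.mem_closedBall, dist_zero_left] at hz
    linarith
  have hb : ∀ n, ∃ C, ∀ z ∈ K, ‖jacQuot s n z‖ ≤ C := fun n =>
    hKc.exists_bound_of_continuousOn fun z hz =>
      (differentiableAt_jacQuot hs hs1 n (hK0 z hz)).continuousAt.continuousWithinAt
  choose C hC using hb
  obtain ⟨M, hM⟩ : ∃ C, ∀ z ∈ K, ‖jac s z‖ ≤ C :=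
    hKc.exists_bound_of_continuousOn fun z hz =>
      (differentiableAt_jac hs hs1 (hK0 z hz)).continuousAt.continuousWithinAt
  have hKz : z₀ ∈ K := Metric.mem_closedBall_self (by positivity)
  have hC0 : ∀ n, 0 ≤ C n := fun n => (norm_nonneg _).trans (hC n z₀ hKz)
  have hM0 : 0 ≤ M := (norm_nonneg _).trans (hM z₀ hKz)
  have hs2 : ‖s‖ ^ 2 < 1 := pow_lt_one₀ hs0.le hs1 two_ne_zero
  obtain ⟨N, hN⟩ := exists_pow_lt_of_lt_one
    (show 0 < min (1 / (4 * ‖z₀‖)) (‖z₀‖ / 4) by positivity) hs2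
  obtain ⟨hN1, hN2⟩ := lt_min_iff.1 hN
  refine ⟨2 * M + ∑ n ∈ Finset.Icc (-(N : ℤ)) N, C n, fun n z hz => ?_⟩
  have hzK : z ∈ K := Metric.ball_subset_closedBall hz
  obtain ⟨b1, b2⟩ := half_ball_bounds hz
  have hsum : 0 ≤ ∑ n ∈ Finset.Icc (-(N : ℤ)) N, C n := Finset.sum_nonneg fun i _ => hC0 i
  have far : 1 / 2 ≤ ‖1 - z * s ^ (2 * n)‖ → ‖jacQuot s n z‖ ≤ 2 * M := by
    intro h
    rw [jacQuot_of_ne hs (norm_pos_iff.1 (by linarith)), norm_div, div_le_iff₀ (by linarith)]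
    nlinarith [hM z hzK]
  have hnorm : ‖z * s ^ (2 * n)‖ = ‖z‖ * (‖s‖ ^ 2) ^ n := by
    rw [norm_mul, norm_zpow, zpow_mul]
    norm_cast
  by_cases hn : n ∈ Finset.Icc (-(N : ℤ)) N
  · have := Finset.single_le_sum (f := C) (fun i _ => hC0 i) hn
    linarith [hC n z hzK]
  · suffices 1 / 2 ≤ ‖1 - z * s ^ (2 * n)‖ by linarith [far this]
    rw [Finset.mem_Icc, not_and_or, not_le, not_le] at hn
    rcases hn with hn | hn
    · have h1 : ((‖s‖ ^ 2) ^ N)⁻¹ ≤ (‖s‖ ^ 2) ^ n := by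
        rw [← zpow_natCast, ← zpow_neg]
        exact zpow_le_zpow_right_of_le_one₀ (by positivity) hs2.le hn.le
      have h2 : 4 / ‖z₀‖ ≤ (‖s‖ ^ 2) ^ n := by
        refine le_trans ?_ h1
        rw [le_inv_comm₀ (by positivity) (by positivity), inv_div]
        exact hN2.le
      have h3 : 2 ≤ ‖z * s ^ (2 * n)‖ := by
        rw [hnorm]
        calc (2 : ℝ) = ‖z₀‖ / 2 * (4 / ‖z₀‖) := by field_simp; norm_num
          _ ≤ _ := by gcongr
      have := norm_sub_norm_le (z * s ^ (2 * n)) 1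
      rw [norm_sub_rev, norm_one] at this
      linarith
    · have h1 : (‖s‖ ^ 2) ^ n ≤ (‖s‖ ^ 2) ^ N := by
        rw [← zpow_natCast]
        exact zpow_le_zpow_right_of_le_one₀ (by positivity) hs2.le hn.le
      have h3 : ‖z * s ^ (2 * n)‖ ≤ 1 / 2 := by
        rw [hnorm]
        calc _ ≤ 2 * ‖z₀‖ * (1 / (4 * ‖z₀‖)) := by gcongr; exact h1.trans hN1.le
          _ = 1 / 2 := by field_simp; norm_num
      have := norm_sub_norm_le 1 (z * s ^ (2 * n))
      rw [norm_one] at this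
      linarith

/-- The Appell–Lerch type series attached to `x`; a vanishing denominator omits its term. -/
noncomputable def lerch (s x z : ℂ) : ℂ :=
  ∑' n : ℤ, (-1) ^ n * s ^ (3 * n * (n + 1)) * x ^ n / (1 - z * s ^ (2 * n))

/-- The product `jac s z * lerch s x z`, extended holomorphically to the punctured plane. -/
noncomputable def lerchJac (s x z : ℂ) : ℂ :=
  ∑' n : ℤ, (-1) ^ n * s ^ (3 * n * (n + 1)) * x ^ n * jacQuot s n z

theorem summable_lerch_coeff {s x : ℂ} (hs : s ≠ 0) (hs1 : ‖s‖ < 1) (hx : x ≠ 0) (b : ℤ) :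
    Summable fun n : ℤ => ‖(-1) ^ n * s ^ (3 * n * (n + 1) + b * n) * x ^ n‖ := by
  refine (summable_quad hs hs1 hx (3 + b) 0 (show (0 : ℤ) < 3 by norm_num)
      (fun n => 3 * n * (n + 1) + b * n) (fun n => by ring)).congr fun n => ?_
  rw [mul_assoc ((-1 : ℂ) ^ n), norm_mul ((-1 : ℂ) ^ n), norm_neg_one_zpow, one_mul]

theorem lerchJac_differentiableOn {s x z₀ : ℂ} (hs : s ≠ 0) (hs1 : ‖s‖ < 1) (hx : x ≠ 0)
    (hz₀ : z₀ ≠ 0) : DifferentiableOn ℂ (lerchJac s x) (Metric.ball z₀ (‖z₀‖ / 2)) ∧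
    Summable (fun n : ℤ => (-1) ^ n * s ^ (3 * n * (n + 1)) * x ^ n * jacQuot s n z₀) ∧
    HasSum (fun n : ℤ => (-1) ^ n * s ^ (3 * n * (n + 1)) * x ^ n * deriv (jacQuot s n) z₀)
      (deriv (lerchJac s x) z₀) := by
  obtain ⟨C, hC⟩ := jacQuot_bounded hs hs1 hz₀
  have hz0 := norm_pos_iff.2 hz₀
  have hsum : Summable fun n : ℤ => ‖(-1) ^ n * s ^ (3 * n * (n + 1)) * x ^ n‖ * C := by
    simpa using (summable_lerch_coeff hs hs1 hx 0).mul_right C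
  have hd : ∀ n : ℤ, ∀ z ∈ Metric.ball z₀ (‖z₀‖ / 2), DifferentiableAt ℂ (jacQuot s n) z := by
    intro n z hz
    have := (half_ball_bounds hz).1
    exact differentiableAt_jacQuot hs hs1 n (norm_pos_iff.1 (by linarith))
  have hb : ∀ n : ℤ, ∀ z ∈ Metric.ball z₀ (‖z₀‖ / 2),
      ‖(-1) ^ n * s ^ (3 * n * (n + 1)) * x ^ n * jacQuot s n z‖ ≤
        ‖(-1) ^ n * s ^ (3 * n * (n + 1)) * x ^ n‖ * C := by
    intro n z hz
    rw [norm_mul]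
    exact mul_le_mul_of_nonneg_left (hC n z hz) (norm_nonneg _)
  have hd' : ∀ n : ℤ, DifferentiableOn ℂ
      (fun z => (-1) ^ n * s ^ (3 * n * (n + 1)) * x ^ n * jacQuot s n z)
        (Metric.ball z₀ (‖z₀‖ / 2)) := fun n z hz =>
    ((hd n z hz).const_mul _).differentiableWithinAt
  have hmem : z₀ ∈ Metric.ball z₀ (‖z₀‖ / 2) := Metric.mem_ball_self (by positivity)
  refine ⟨Complex.differentiableOn_tsum_of_summable_norm hsum hd' Metric.isOpen_ball hb,
    Summable.of_norm_bounded hsum fun n => hb n z₀ hmem, ?_⟩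
  refine (Complex.hasSum_deriv_of_summable_norm hsum hd' Metric.isOpen_ball hb hmem).congr_fun ?_
  intro n
  rw [deriv_const_mul _ (hd n z₀ hmem)]

theorem differentiableAt_lerchJac {s x z : ℂ} (hs : s ≠ 0) (hs1 : ‖s‖ < 1) (hx : x ≠ 0)
    (hz : z ≠ 0) : DifferentiableAt ℂ (lerchJac s x) z :=
  (lerchJac_differentiableOn hs hs1 hx hz).1.differentiableAt
    (Metric.ball_mem_nhds _ (by have := norm_pos_iff.2 hz; positivity))

theorem lerchJac_eq {s x z : ℂ} (hs : s ≠ 0) (hz : jac s z ≠ 0) :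
    lerchJac s x z = jac s z * lerch s x z := by
  rw [lerchJac, lerch, ← tsum_mul_left]
  refine tsum_congr fun n => ?_
  rw [jacQuot_of_ne hs]
  · ring
  · intro h
    exact hz (by rw [eq_of_one_sub_eq_zero h, jac_neg_zpow hs])

theorem one_sub_zpow_ne_zero {s : ℂ} (hs1 : ‖s‖ < 1) {n : ℤ} (hn : n ≠ 0) :
    1 - s ^ (2 * n) ≠ 0 := by
  intro h
  have h1 : ‖s‖ ^ (2 * n) = 1 := by rw [← norm_zpow, ← sub_eq_zero.1 h, norm_one]
  rw [zpow_eq_one_iff_right₀ (norm_nonneg s) hs1.ne] at h1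
  omega

theorem lerchJac_one {s x : ℂ} (hs : s ≠ 0) (hs1 : ‖s‖ < 1) :
    lerchJac s x 1 = -deriv (jac s) 1 := by
  rw [lerchJac, tsum_eq_single 0]
  · have := jacQuot_pole s 0
    simp only [mul_zero, neg_zero, zpow_zero] at this
    simp [this]
  · intro n hn
    rw [jacQuot_of_ne hs (by rw [one_mul]; exact one_sub_zpow_ne_zero hs1 hn), jac_one]
    simp

theorem deriv_jacQuot_zero {s : ℂ} (hs : s ≠ 0) (hs1 : ‖s‖ < 1) : deriv (jacQuot s 0) 1 = 0 := by
  have hd := (differentiableAt_jacQuot hs hs1 0 one_ne_zero).hasDerivAt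
  have h1 : HasDerivAt (fun z : ℂ => jacQuot s 0 z⁻¹)
      (deriv (jacQuot s 0) 1 * (-((1 : ℂ) ^ 2)⁻¹)) 1 :=
    HasDerivAt.comp (1 : ℂ) (h₂ := jacQuot s 0) (by simpa using hd) (hasDerivAt_inv one_ne_zero)
  have h2 : (fun z : ℂ => jacQuot s 0 z⁻¹) =ᶠ[𝓝 1] jacQuot s 0 := by
    filter_upwards [isOpen_ne.mem_nhds (one_ne_zero (α := ℂ))] with z hz
    by_cases h : z = 1
    · simp [h]
    · have h' : 1 - z ≠ 0 := sub_ne_zero.2 (Ne.symm h)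
      have h'' : 1 - z⁻¹ ≠ 0 := by
        rw [sub_ne_zero]
        intro e
        exact h (by rw [← inv_inv z, ← e, inv_one])
      rw [jacQuot_of_ne hs (by simpa using h''), jacQuot_of_ne hs (by simpa using h'), jac_inv hz,
        div_eq_div_iff (by simpa using h'') (by simpa using h')]
      simp only [mul_zero, zpow_zero, mul_one]
      field_simp
      ring
  have h3 := (h1.congr_of_eventuallyEq h2.symm).unique hd
  simp only [one_pow, inv_one, mul_neg, mul_one] at h3
  exact self_eq_neg.1 h3.symm

theorem deriv_lerchJac_one {s x : ℂ} (hs : s ≠ 0) (hs1 : ‖s‖ < 1) (hx : x ≠ 0) :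
    deriv (lerchJac s x) 1 = deriv (jac s) 1 * lerch s x 1 := by
  rw [← (lerchJac_differentiableOn hs hs1 hx one_ne_zero).2.2.tsum_eq, lerch, ← tsum_mul_left]
  refine tsum_congr fun n => ?_
  by_cases hn : n = 0
  · subst hn
    simp [deriv_jacQuot_zero hs hs1]
  · have h := one_sub_zpow_ne_zero hs1 hn
    have hd := (differentiableAt_jac hs hs1 one_ne_zero).hasDerivAt
    have h1 : HasDerivAt (fun z : ℂ => 1 - z * s ^ (2 * n)) (-(1 * s ^ (2 * n))) 1 :=
      ((hasDerivAt_id (1 : ℂ)).mul_const _).const_sub 1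
    have h2 := hd.div h1 (by rwa [one_mul])
    have h3 : jacQuot s n =ᶠ[𝓝 1] jac s / fun z : ℂ => 1 - z * s ^ (2 * n) := by
      filter_upwards [h1.continuousAt.eventually_ne (by simpa using h)] with z hz
      exact jacQuot_of_ne hs hz
    rw [(h2.congr_of_eventuallyEq h3).deriv, jac_one]
    simp only [one_mul, zero_mul, sub_zero]
    field_simp

theorem lerchJac_sq_mul {s x z : ℂ} (hs : s ≠ 0) (hs1 : ‖s‖ < 1) (hx : x ≠ 0) (hz : z ≠ 0) :
    lerchJac s x (s ^ 2 * z) = z ^ 2 * x⁻¹ * lerchJac s x z + z⁻¹ * x⁻¹ * jac s z *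
      (jac (s ^ 3) x + z * jac (s ^ 3) (s ^ 2 * x) + z ^ 2 * jac (s ^ 3) (s ^ 4 * x)) := by
  have h0 := (lerchJac_differentiableOn hs hs1 hx hz).2.1
  have hc : ∀ j : ℕ, jac (s ^ 3) (s ^ (2 * j) * x) =
      ∑' n : ℤ, (-1) ^ n * s ^ (3 * n * (n + 1) + (2 * j - 6 : ℤ) * n) * x ^ n := by
    intro j
    refine tsum_congr fun n => ?_
    have e1 : (s ^ 3) ^ (n * (n - 1)) = s ^ (3 * (n * (n - 1))) := by
      rw [zpow_mul s 3]; norm_cast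
    have e2 : (s ^ (2 * j)) ^ n = s ^ (2 * j * n : ℤ) := by
      rw [zpow_mul s (2 * j)]; norm_cast
    rw [e1, mul_zpow, e2, zpow_split hs (show 3 * n * (n + 1) + (2 * j - 6 : ℤ) * n =
      3 * (n * (n - 1)) + 2 * j * n by ring)]
    ring
  have hS : ∀ j : ℕ, Summable fun n : ℤ =>
      (-1) ^ n * s ^ (3 * n * (n + 1) + (2 * j - 6 : ℤ) * n) * x ^ n :=
    fun j => (summable_lerch_coeff hs hs1 hx _).of_norm
  have c0 := hc 0
  have c1 := hc 1
  have c2 := hc 2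
  rw [mul_zero, pow_zero, one_mul] at c0
  rw [mul_one] at c1
  rw [show 2 * 2 = 4 from rfl] at c2
  rw [c0, c1, c2, ← tsum_mul_left (a := z), ← tsum_mul_left (a := z ^ 2),
    ← Summable.tsum_add (hS 0) ((hS 1).mul_left z),
    ← Summable.tsum_add ((hS 0).add ((hS 1).mul_left z)) ((hS 2).mul_left (z ^ 2)),
    ← tsum_mul_left]
  unfold lerchJac
  rw [← tsum_mul_left, ← Summable.tsum_add (h0.mul_left _)
    ((((hS 0).add ((hS 1).mul_left z)).add ((hS 2).mul_left (z ^ 2))).mul_left _),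
    ← (Equiv.addRight (1 : ℤ)).tsum_eq (fun n : ℤ => z ^ 2 * x⁻¹ * _ + _)]
  refine tsum_congr fun m => ?_
  simp only [Equiv.coe_addRight]
  rw [jacQuot_sq_mul hs hs1 hz]
  set n := m + 1 with hn
  rw [show m = n - 1 by omega, ← one_sub_mul_jacQuot hs n z,
    show (-1 : ℂ) ^ (n - 1) = -(-1) ^ n by
      rw [← neg_neg ((-1 : ℂ) ^ (n - 1)), ← neg_one_zpow_succ, sub_add_cancel],
    zpow_sub_one₀ hx]
  have hw := zpow_ne_zero (2 * n) hs
  have p6 : s ^ (6 * n) = (s ^ (2 * n)) ^ 3 := by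
    rw [show 6 * n = 2 * n * 3 by ring, zpow_mul]; norm_cast
  have p4 : s ^ (4 * n) = (s ^ (2 * n)) ^ 2 := by
    rw [show 4 * n = 2 * n * 2 by ring, zpow_mul]; norm_cast
  have q0 : s ^ (3 * n * (n + 1)) =
      s ^ (3 * n * (n + 1) + (2 * (0 : ℕ) - 6 : ℤ) * n) * (s ^ (2 * n)) ^ 3 := by
    rw [← p6, ← zpow_add₀ hs]; congr 1; push_cast; ring
  have q1 : s ^ (3 * n * (n + 1) + (2 * (1 : ℕ) - 6 : ℤ) * n) =
      s ^ (3 * n * (n + 1) + (2 * (0 : ℕ) - 6 : ℤ) * n) * s ^ (2 * n) := by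
    rw [← zpow_add₀ hs]; congr 1; push_cast; ring
  have q2 : s ^ (3 * n * (n + 1) + (2 * (2 : ℕ) - 6 : ℤ) * n) =
      s ^ (3 * n * (n + 1) + (2 * (0 : ℕ) - 6 : ℤ) * n) * (s ^ (2 * n)) ^ 2 := by
    rw [← p4, ← zpow_add₀ hs]; congr 1; push_cast; ring
  have q3 : s ^ (3 * (n - 1) * n) =
      s ^ (3 * n * (n + 1) + (2 * (0 : ℕ) - 6 : ℤ) * n) := by
    congr 1; push_cast; ring
  rw [q1, q2, q3, q0]
  field_simp
  ring

theorem jac_cube_eq (s z : ℂ) (hs : s ≠ 0) (j : ℕ) :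
    jac (s ^ 3) (s ^ j * z) = ∑' n : ℤ, (-1) ^ n * s ^ (n * (3 * n + (j - 3))) * z ^ n := by
  refine tsum_congr fun n => ?_
  have e1 : (s ^ 3) ^ (n * (n - 1)) = s ^ (3 * (n * (n - 1))) := by
    rw [zpow_mul s 3]; norm_cast
  have e2 : (s ^ j) ^ n = s ^ (j * n : ℤ) := by rw [zpow_mul s j]; norm_cast
  rw [e1, mul_zpow, e2, zpow_split hs (show n * (3 * n + (j - 3)) =
      3 * (n * (n - 1)) + j * n by ring)]
  ring

theorem jac_cube_sq (s : ℂ) (hs : s ≠ 0) :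
    jac (s ^ 3) (s ^ 2) = pent s ∧ jac (s ^ 3) (s ^ 4) = pent s := by
  have h2 := jac_cube_eq s 1 hs 2
  have h4 := jac_cube_eq s 1 hs 4
  rw [mul_one] at h2 h4
  rw [h2, h4]
  constructor
  · rw [pent, ← (Equiv.neg ℤ).tsum_eq]
    refine tsum_congr fun n => ?_
    rw [Equiv.neg_apply, one_zpow, mul_one, neg_one_zpow_neg]
    congr 2
    push_cast
    ring
  · refine tsum_congr fun n => ?_
    rw [one_zpow, mul_one]
    congr 2

theorem jac_cube_inv (s : ℂ) {z : ℂ} (hs : s ≠ 0) :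
    jac (s ^ 3) (s ^ 2 * z⁻¹) = jac (s ^ 3) (s ^ 4 * z) := by
  rw [jac_cube_eq s _ hs, jac_cube_eq s _ hs, ← (Equiv.neg ℤ).tsum_eq]
  refine tsum_congr fun n => ?_
  rw [Equiv.neg_apply, neg_one_zpow_neg, inv_zpow, zpow_neg, inv_inv]
  congr 3
  push_cast
  ring

theorem quintuple_jac {s z : ℂ} (hs : s ≠ 0) (hs1 : ‖s‖ < 1) (hz : z ≠ 0) :
    jac s z * (jac (s ^ 3) (s ^ 2 * z ^ 3) + z * jac (s ^ 3) (s ^ 4 * z ^ 3)) =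
      pent s * jac s (z ^ 2) := by
  obtain ⟨hq1, hq2⟩ := summable_quint hs hs1 hz
  rw [← quintuple hs hs1 hz, jac_cube_eq s _ hs, jac_cube_eq s _ hs, ← tsum_mul_left]
  have e1 : ∀ n : ℤ, (-1 : ℂ) ^ n * s ^ (n * (3 * n + ((2 : ℕ) - 3))) * (z ^ 3) ^ n =
      (-1) ^ n * s ^ (n * (3 * n - 1)) * z ^ (3 * n) := by
    intro n
    rw [cube_zpow]
    congr 3
  have e2 : ∀ n : ℤ, z * ((-1 : ℂ) ^ n * s ^ (n * (3 * n + ((4 : ℕ) - 3))) * (z ^ 3) ^ n) =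
      (-1) ^ n * s ^ (n * (3 * n + 1)) * z ^ (3 * n + 1) := by
    intro n
    rw [cube_zpow, zpow_add_one₀ hz, show ((4 : ℕ) - 3 : ℤ) = 1 by norm_num]
    ring
  simp_rw [e1, e2]
  rw [← Summable.tsum_add hq1.of_norm hq2.of_norm]
  congr 1
  refine tsum_congr fun n => ?_
  rw [zpow_split hs (show n * (3 * n + 1) = n * (3 * n - 1) + 2 * n by ring), zpow_add_one₀ hz]
  ring

/-- The elliptic function behind the three-term relation for `lerch`. -/
noncomputable def lerchComb (s ζ z : ℂ) : ℂ :=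
  jac s z * jac s (z * ζ) * lerchJac s (ζ⁻¹ ^ 3) (z * ζ⁻¹) +
    ζ ^ 3 * jac s z * jac s (z * ζ⁻¹) * lerchJac s (ζ ^ 3) (z * ζ) -
    ζ * (jac s (ζ ^ 2) / jac s ζ) * jac s (z * ζ) * jac s (z * ζ⁻¹) * lerchJac s 1 z

theorem lerchComb_const {s ζ z : ℂ} (hs : s ≠ 0) (hs1 : ‖s‖ < 1) (hζ : ζ ≠ 0)
    (hj : jac s ζ ≠ 0) (hz : z ≠ 0) :
    lerchComb s ζ z = -deriv (jac s) 1 * jac s ζ * jac s (ζ ^ 2) := by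
  have hζ' := inv_ne_zero hζ
  have h := eq_of_elliptic (q := s ^ 2) (f := lerchComb s ζ) (pow_ne_zero 2 hs)
    (by rw [norm_pow]; exact pow_lt_one₀ (norm_nonneg s) hs1 two_ne_zero) ?_ ?_ hz one_ne_zero
  · rw [h, lerchComb, jac_one, one_mul, one_mul, jac_inv hζ, lerchJac_one hs hs1]
    field_simp
    ring
  · intro z hz
    have m : ∀ w : ℂ, w ≠ 0 → DifferentiableAt ℂ (fun z => z * w) z := fun w _ =>
      (differentiableAt_id).mul_const w
    have j : ∀ w : ℂ, w ≠ 0 → DifferentiableAt ℂ (fun z => jac s (z * w)) z := fun w hw =>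
      DifferentiableAt.comp (g := jac s) z (differentiableAt_jac hs hs1 (mul_ne_zero hz hw))
        (m w hw)
    have l : ∀ x w : ℂ, x ≠ 0 → w ≠ 0 → DifferentiableAt ℂ (fun z => lerchJac s x (z * w)) z :=
      fun x w hx hw => DifferentiableAt.comp (g := lerchJac s x) z
        (differentiableAt_lerchJac hs hs1 hx (mul_ne_zero hz hw)) (m w hw)
    have j0 := differentiableAt_jac hs hs1 hz
    have l0 := differentiableAt_lerchJac hs hs1 one_ne_zero hz
    exact (((j0.mul (j _ hζ)).mul (l _ _ (pow_ne_zero 3 hζ') hζ')).add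
      (((j0.const_mul _).mul (j _ hζ')).mul (l _ _ (pow_ne_zero 3 hζ) hζ))).sub
      ((((j _ hζ).const_mul _).mul (j _ hζ')).mul l0)
  · intro z hz
    have hquint := quintuple_jac hs hs1 hζ
    obtain ⟨t1, t2⟩ := jac_cube_sq s hs
    have i1 := jac_cube_inv s (z := ζ ^ 3) hs
    have i2 := jac_cube_inv s (z := ζ⁻¹ ^ 3) hs
    rw [inv_pow, inv_inv] at i2
    have i0 := jac_inv (s := s ^ 3) (z := ζ ^ 3) (pow_ne_zero 3 hζ)
    have j1 := jac_one (s ^ 3)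
    unfold lerchComb
    rw [mul_assoc (s ^ 2) z ζ, mul_assoc (s ^ 2) z ζ⁻¹,
      jac_sq_mul hs hz, jac_sq_mul hs (mul_ne_zero hz hζ), jac_sq_mul hs (mul_ne_zero hz hζ'),
      lerchJac_sq_mul hs hs1 (pow_ne_zero 3 hζ') (mul_ne_zero hz hζ'),
      lerchJac_sq_mul hs hs1 (pow_ne_zero 3 hζ) (mul_ne_zero hz hζ),
      lerchJac_sq_mul hs hs1 one_ne_zero hz, mul_one, mul_one, t1, t2, j1]
    simp only [inv_pow]
    rw [i0, i1, ← i2]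
    generalize jac (s ^ 3) (s ^ 2 * ζ ^ 3) = A at *
    generalize jac (s ^ 3) (s ^ 4 * ζ ^ 3) = B at *
    field_simp
    linear_combination (ζ * jac s z * jac s (z * ζ) * jac s (z / ζ) * z * (1 + z)) * hquint

/-- The three-term relation for `lerch`. -/
theorem lerch_three_term {s ζ z : ℂ} (hs : s ≠ 0) (hs1 : ‖s‖ < 1) (hζ : ζ ≠ 0) (hz : z ≠ 0)
    (hj : jac s ζ ≠ 0) (hjz : jac s z ≠ 0) (hj1 : jac s (z * ζ) ≠ 0) (hj2 : jac s (z * ζ⁻¹) ≠ 0) :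
    lerch s (ζ⁻¹ ^ 3) (z * ζ⁻¹) + ζ ^ 3 * lerch s (ζ ^ 3) (z * ζ) =
      ζ * (jac s (ζ ^ 2) / jac s ζ) * lerch s 1 z +
        -deriv (jac s) 1 * jac s ζ * jac s (ζ ^ 2) /
          (jac s (z * ζ⁻¹) * jac s z * jac s (z * ζ)) := by
  have h := lerchComb_const hs hs1 hζ hj hz
  rw [lerchComb, lerchJac_eq hs hj2, lerchJac_eq hs hj1, lerchJac_eq hs hjz] at h
  rw [← h]
  generalize jac s (z * ζ⁻¹) = a at *
  generalize jac s (z * ζ) = b at *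
  field_simp
  ring

/-- The logarithmic derivative `z j'(z) / j(z)`. -/
noncomputable def jacLog (s z : ℂ) : ℂ := z * deriv (jac s) z / jac s z

/-- The three-term relation for `lerch` at the pole of its first term. -/
theorem lerch_three_term_pole {s ζ : ℂ} (hs : s ≠ 0) (hs1 : ‖s‖ < 1) (hζ : ζ ≠ 0)
    (hj : jac s ζ ≠ 0) (hj2 : jac s (ζ ^ 2) ≠ 0) (hD : deriv (jac s) 1 ≠ 0) :
    lerch s (ζ⁻¹ ^ 3) 1 + ζ ^ 3 * lerch s (ζ ^ 3) (ζ ^ 2) =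
      ζ * (jac s (ζ ^ 2) / jac s ζ) * lerch s 1 ζ + jacLog s ζ + jacLog s (ζ ^ 2) := by
  have hζ' := inv_ne_zero hζ
  have hc : lerchComb s ζ =ᶠ[𝓝 ζ] fun _ => -deriv (jac s) 1 * jac s ζ * jac s (ζ ^ 2) := by
    filter_upwards [isOpen_ne.mem_nhds hζ] with z hz
    exact lerchComb_const hs hs1 hζ hj hz
  have h0 : HasDerivAt (lerchComb s ζ) 0 ζ := (hasDerivAt_const ζ _).congr_of_eventuallyEq hc
  have m : ∀ w : ℂ, HasDerivAt (fun z => z * w) w ζ := fun w => by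
    simpa using (hasDerivAt_id ζ).mul_const w
  have j : ∀ w : ℂ, w ≠ 0 → HasDerivAt (fun z => jac s (z * w)) (deriv (jac s) (ζ * w) * w) ζ :=
    fun w hw => HasDerivAt.comp ζ (h₂ := jac s)
      (differentiableAt_jac hs hs1 (mul_ne_zero hζ hw)).hasDerivAt (m w)
  have l : ∀ x w : ℂ, x ≠ 0 → w ≠ 0 → HasDerivAt (fun z => lerchJac s x (z * w))
      (deriv (lerchJac s x) (ζ * w) * w) ζ :=
    fun x w hx hw => HasDerivAt.comp ζ (h₂ := lerchJac s x)
      (differentiableAt_lerchJac hs hs1 hx (mul_ne_zero hζ hw)).hasDerivAt (m w)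
  have j0 := (differentiableAt_jac hs hs1 hζ).hasDerivAt
  have l0 := (differentiableAt_lerchJac hs hs1 one_ne_zero hζ).hasDerivAt
  have h1 := (((j0.mul (j _ hζ)).mul (l _ _ (pow_ne_zero 3 hζ') hζ')).add
      (((j0.const_mul (ζ ^ 3)).mul (j _ hζ')).mul (l _ _ (pow_ne_zero 3 hζ) hζ))).sub
      ((((j _ hζ).const_mul (ζ * (jac s (ζ ^ 2) / jac s ζ))).mul (j _ hζ')).mul l0)
  have h2 := h0.unique h1
  simp only [Pi.mul_apply, mul_inv_cancel₀ hζ, jac_one, lerchJac_one hs hs1,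
    deriv_lerchJac_one hs hs1 (pow_ne_zero 3 hζ'), ← pow_two, mul_zero, zero_mul, add_zero,
    zero_add] at h2
  rw [lerchJac_eq hs hj, lerchJac_eq hs hj2] at h2
  rw [jacLog, jacLog]
  field_simp at h2
  rw [zero_mul] at h2
  have h3 := (mul_eq_zero.1 h2.symm).resolve_left hD
  field_simp
  linear_combination h3

theorem tsum_ne_zero_of_geometric {f : ℤ → ℂ} {r : ℝ} (hr : 0 ≤ r) (hr3 : r < 1 / 3)
    (h0 : f 0 = 1) (hf : ∀ n, ‖f n‖ ≤ r ^ n.natAbs) : ∑' n, f n ≠ 0 := by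
  have hr1 : r < 1 := by linarith
  have h1 : HasSum (fun n : ℕ => r ^ (n : ℤ).natAbs) (1 - r)⁻¹ := by
    simpa using hasSum_geometric_of_lt_one hr hr1
  have h2 : HasSum (fun n : ℕ => r ^ (-((n : ℤ) + 1)).natAbs) (r * (1 - r)⁻¹) := by
    refine ((hasSum_geometric_of_lt_one hr hr1).mul_left r).congr_fun fun n => ?_
    rw [show (-((n : ℤ) + 1)).natAbs = n + 1 by omega, pow_succ']
  have h3 := HasSum.of_nat_of_neg_add_one (f := fun n : ℤ => r ^ n.natAbs) h1 h2
  have h4 := h3.sub (hasSum_ite_eq (0 : ℤ) (1 : ℝ))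
  have hs : Summable f := Summable.of_norm_bounded h3.summable hf
  have h5 := hs.hasSum.sub (hasSum_ite_eq (0 : ℤ) (1 : ℂ))
  intro hz
  have h6 : ‖∑' n, f n - 1‖ ≤ (1 - r)⁻¹ + r * (1 - r)⁻¹ - 1 := by
    rw [← h5.tsum_eq]
    refine tsum_of_norm_bounded h4 fun n => ?_
    by_cases hn : n = 0
    · simp [hn, h0]
    · simpa [hn] using hf n
  rw [hz, zero_sub, norm_neg, norm_one] at h6
  have h7 : (1 - r)⁻¹ < 3 / 2 := by
    rw [inv_lt_comm₀ (by linarith) (by norm_num)]; linarith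
  nlinarith

theorem tsum_sign_zpow_ne_zero {s : ℂ} (hs3 : ‖s‖ < 1 / 3) (e : ℤ → ℤ)
    (h0 : e 0 = 0) (he : ∀ n, (n.natAbs : ℤ) ≤ e n) : ∑' n : ℤ, (-1) ^ n * s ^ e n ≠ 0 := by
  refine tsum_ne_zero_of_geometric (norm_nonneg s) hs3 (by simp [h0]) fun n => ?_
  obtain ⟨m, hm⟩ := Int.eq_ofNat_of_zero_le ((Int.natCast_nonneg n.natAbs).trans (he n))
  rw [norm_mul, norm_neg_one_zpow, one_mul, norm_zpow, hm, zpow_natCast]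
  exact pow_le_pow_of_le_one (norm_nonneg s) (by linarith) (by have := he n; omega)

theorem pent_ne_zero {s : ℂ} (hs3 : ‖s‖ < 1 / 3) : pent s ≠ 0 := by
  refine tsum_sign_zpow_ne_zero hs3 (fun n => n * (3 * n + 1)) (by simp) fun n => ?_
  rcases le_or_gt 0 n with h | h
  · rw [Int.natAbs_of_nonneg h]; nlinarith
  · rw [Int.ofNat_natAbs_of_nonpos h.le]; nlinarith

theorem jac_seven_ne_zero {s : ℂ} (hs : s ≠ 0) (hs3 : ‖s‖ < 1 / 3) {k : ℕ} (hk : 1 ≤ k)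
    (hk3 : k ≤ 3) : jac (s ^ 7) ((s ^ 2) ^ k) ≠ 0 := by
  have := tsum_sign_zpow_ne_zero hs3 (fun n => 7 * (n * (n - 1)) + 2 * k * n) (by simp) fun n => by
    rcases le_or_gt 0 n with h | h
    · rw [Int.natAbs_of_nonneg h]
      have : 0 ≤ n * (n - 1) := by
        rcases h.eq_or_lt with rfl | h
        · simp
        · exact mul_nonneg h.le (by omega)
      have : n ≤ k * n := by nlinarith
      linarith
    · rw [Int.ofNat_natAbs_of_nonpos h.le]
      nlinarith
  have e : jac (s ^ 7) ((s ^ 2) ^ k) =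
      ∑' n : ℤ, (-1) ^ n * s ^ (7 * (n * (n - 1)) + 2 * k * n) := tsum_congr fun n => by
    rw [zpow_add₀ hs, zpow_mul s 7, zpow_mul s (2 * k), mul_assoc, ← pow_mul, ← zpow_natCast s 7,
      ← zpow_natCast s (2 * k)]
    push_cast
    rfl
  rwa [e]

theorem deriv_jac_one_ne_zero {s : ℂ} (hs : s ≠ 0) (hs6 : ‖s‖ < 1 / 6) :
    deriv (jac s) 1 ≠ 0 := by
  rw [← (jac_differentiableOn hs (by linarith) one_ne_zero).2.tsum_eq, ← neg_ne_zero, ← tsum_neg,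
    ← (Equiv.addRight (1 : ℤ)).tsum_eq]
  refine tsum_ne_zero_of_geometric (r := 2 * ‖s‖) (by positivity) (by linarith)
    (by simp) fun n => ?_
  simp only [Equiv.coe_addRight, one_zpow, mul_one, norm_neg, norm_mul,
    norm_zpow, add_sub_cancel_right]
  rcases eq_or_ne n (-1) with rfl | hn
  · simp
  obtain ⟨m, hm⟩ : ∃ m : ℕ, (n + 1) * n = m :=
    Int.eq_ofNat_of_zero_le (by
      rcases le_or_gt 0 n with h | h
      · positivity
      · exact mul_nonneg_of_nonpos_of_nonpos (by omega) h.le)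
  rw [hm, zpow_natCast, mul_pow, mul_comm]
  have h1 : n.natAbs ≤ m := by
    zify
    rcases le_or_gt 0 n with h | h
    · rw [abs_of_nonneg h]; nlinarith
    · rw [abs_of_neg h]
      have : n ≤ -2 := by omega
      nlinarith
  have h2 : ‖((n + 1 : ℤ) : ℂ)‖ ≤ 2 ^ n.natAbs := by
    rw [Complex.norm_intCast]
    have : n.natAbs + 1 ≤ 2 ^ n.natAbs := Nat.lt_two_pow_self
    calc |((n + 1 : ℤ) : ℝ)| = ((n + 1).natAbs : ℝ) := by rw [Nat.cast_natAbs, Int.cast_abs]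
      _ ≤ ((2 ^ n.natAbs : ℕ) : ℝ) := by
        exact_mod_cast (by omega : (n + 1).natAbs ≤ n.natAbs + 1).trans this
      _ = _ := by push_cast; rfl
  rw [norm_one, one_zpow, one_mul]
  exact mul_le_mul h2 (pow_le_pow_of_le_one (norm_nonneg s) (by linarith) h1) (by positivity)
    (by positivity)

theorem jacLog_inv {s z : ℂ} (hs : s ≠ 0) (hs1 : ‖s‖ < 1) (hz : z ≠ 0) (hj : jac s z ≠ 0) :
    jacLog s z⁻¹ = 1 - jacLog s z := by
  have hd := (differentiableAt_jac hs hs1 hz).hasDerivAt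
  have hd2 := (differentiableAt_jac hs hs1 (inv_ne_zero hz)).hasDerivAt
  have h1 : HasDerivAt (fun w => jac s w⁻¹) (deriv (jac s) z⁻¹ * (-(z ^ 2)⁻¹)) z :=
    HasDerivAt.comp z (h₂ := jac s) hd2 (hasDerivAt_inv hz)
  have h2 := ((hasDerivAt_inv hz).neg).mul hd
  have h3 : (fun w => jac s w⁻¹) =ᶠ[𝓝 z] (-fun w => w⁻¹) * jac s := by
    filter_upwards [isOpen_ne.mem_nhds hz] with w hw
    simpa using jac_inv hw
  have h4 := (h1.congr_of_eventuallyEq h3.symm).unique h2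
  simp only [Pi.neg_apply] at h4
  rw [jacLog, jacLog, jac_inv hz]
  field_simp at h4 ⊢
  linear_combination h4

theorem jacLog_sq_mul {s z : ℂ} (hs : s ≠ 0) (hs1 : ‖s‖ < 1) (hz : z ≠ 0) (hj : jac s z ≠ 0) :
    jacLog s (s ^ 2 * z) = jacLog s z - 1 := by
  have hd := (differentiableAt_jac hs hs1 hz).hasDerivAt
  have hd2 := (differentiableAt_jac hs hs1 (mul_ne_zero (pow_ne_zero 2 hs) hz)).hasDerivAt
  have h1 : HasDerivAt (fun w => jac s (s ^ 2 * w)) (deriv (jac s) (s ^ 2 * z) * (s ^ 2 * 1)) z :=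
    hd2.comp z ((hasDerivAt_id z).const_mul (s ^ 2))
  have h2 := ((hasDerivAt_inv hz).neg).mul hd
  have h3 : (fun w => jac s (s ^ 2 * w)) =ᶠ[𝓝 z] (-fun w => w⁻¹) * jac s := by
    filter_upwards [isOpen_ne.mem_nhds hz] with w hw
    simpa using jac_sq_mul hs hw
  have h4 := (h1.congr_of_eventuallyEq h3.symm).unique h2
  simp only [Pi.neg_apply] at h4
  rw [jacLog, jacLog, jac_sq_mul hs hz]
  field_simp at h4 ⊢
  linear_combination -h4

/-- Weierstrass's relation, differentiated on the diagonal `a = b`. -/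
theorem weierstrass_deriv {s b c d : ℂ} (hs : s ≠ 0) (hs1 : ‖s‖ < 1) (hb : b ≠ 0)
    (hc : c ≠ 0) (hd : d ≠ 0) (hbc : jac s (b * c) ≠ 0) (hbc' : jac s (b / c) ≠ 0)
    (hbd : jac s (b * d) ≠ 0) (hbd' : jac s (b / d) ≠ 0) :
    deriv (jac s) 1 * jac s (b ^ 2) * (jac s (c * d) * jac s (c / d) / c) =
      jac s (b * c) * jac s (b / c) * (jac s (b * d) * jac s (b / d)) / b *
        (jacLog s (b * c) + jacLog s (b / c) - jacLog s (b * d) - jacLog s (b / d)) := by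
  have m : ∀ w : ℂ, HasDerivAt (fun z => z * w) w b := fun w => by
    simpa using (hasDerivAt_id b).mul_const w
  have j : ∀ w : ℂ, w ≠ 0 → HasDerivAt (fun z => jac s (z * w)) (deriv (jac s) (b * w) * w) b :=
    fun w hw => HasDerivAt.comp b (h₂ := jac s)
      (differentiableAt_jac hs hs1 (mul_ne_zero hb hw)).hasDerivAt (m w)
  have h1 := fun w (hw : w ≠ 0) => (j w hw).mul (j w⁻¹ (inv_ne_zero hw))
  have h2 := (((h1 b hb).mul_const (jac s (c * d) * jac s (c / d) / c)).sub
    ((h1 c hc).mul_const (jac s (b * d) * jac s (b / d) / b))).add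
    ((h1 d hd).mul_const (jac s (b * c) * jac s (b / c) / b))
  have h4 := (hasDerivAt_const b (0 : ℂ)).unique (h2.congr_of_eventuallyEq (by
    filter_upwards [isOpen_ne.mem_nhds hb] with z hz
    have := weierstrass hs hs1 hz hb hc hd
    simp only [Pi.mul_apply, Pi.add_apply, Pi.sub_apply, ← div_eq_mul_inv]
    field_simp at this ⊢
    linear_combination -this))
  simp only [mul_inv_cancel₀ hb, jac_one, mul_zero, zero_add, ← pow_two,
    ← div_eq_mul_inv] at h4
  simp only [jacLog]
  generalize jac s (b * c) = p1 at *
  generalize jac s (b * d) = p2 at *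
  generalize jac s (b / c) = p3 at *
  generalize jac s (b / d) = p4 at *
  generalize jac s (c * d) = p5 at *
  generalize jac s (c / d) = p6 at *
  generalize jac s (b ^ 2) = p7 at *
  generalize deriv (jac s) (b * c) = q1 at *
  generalize deriv (jac s) (b * d) = q2 at *
  generalize deriv (jac s) (b / c) = q3 at *
  generalize deriv (jac s) (b / d) = q4 at *
  generalize deriv (jac s) 1 = q5 at *
  field_simp at h4 ⊢
  linear_combination -h4

theorem jac_sq_mul_inv {s z : ℂ} (hs : s ≠ 0) (hz : z ≠ 0) : jac s (s ^ 2 * z⁻¹) = jac s z := by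
  rw [jac_sq_mul hs (inv_ne_zero hz), jac_inv hz, inv_inv]
  field_simp

/-- The theta values `jac (s ^ 7) (y ^ k)` at the seventh-order points, with `y = s ^ 2`. -/
noncomputable def theta7 (s : ℂ) (k : ℤ) : ℂ := jac (s ^ 7) ((s ^ 2) ^ k)

/-- The logarithmic derivative at the seventh-order points. -/
noncomputable def thetaLog7 (s : ℂ) (k : ℤ) : ℂ := jacLog (s ^ 7) ((s ^ 2) ^ k)

theorem pow_two_zpow_seven_sub {s : ℂ} (hs : s ≠ 0) (k : ℤ) :
    (s ^ 2) ^ (7 - k) = (s ^ 7) ^ 2 * ((s ^ 2) ^ k)⁻¹ := by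
  rw [zpow_sub₀ (pow_ne_zero 2 hs), div_eq_mul_inv]
  congr 1
  norm_cast
  ring

theorem theta7_seven_sub {s : ℂ} (hs : s ≠ 0) (k : ℤ) : theta7 s (7 - k) = theta7 s k := by
  rw [theta7, pow_two_zpow_seven_sub hs,
    jac_sq_mul_inv (pow_ne_zero 7 hs) (zpow_ne_zero k (pow_ne_zero 2 hs)), theta7]

theorem theta7_neg {s : ℂ} (hs : s ≠ 0) (k : ℤ) :
    theta7 s (-k) = -((s ^ 2) ^ k)⁻¹ * theta7 s k := by
  rw [theta7, zpow_neg, jac_inv (zpow_ne_zero k (pow_ne_zero 2 hs)), theta7]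

theorem theta7_ne_zero {s : ℂ} (hs : s ≠ 0) (hs3 : ‖s‖ < 1 / 3) {k : ℤ} (hk : 1 ≤ k)
    (hk3 : k ≤ 6) : theta7 s k ≠ 0 := by
  have h : ∀ j : ℕ, 1 ≤ j → j ≤ 3 → theta7 s j ≠ 0 := fun j h1 h3 => by
    rw [theta7, zpow_natCast]
    exact jac_seven_ne_zero hs hs3 h1 h3
  rcases le_or_gt k 3 with h3 | h3
  · lift k to ℕ using by omega
    exact h k (by omega) (by omega)
  · rw [← theta7_seven_sub hs]
    obtain ⟨j, hj⟩ := Int.eq_ofNat_of_zero_le (show 0 ≤ 7 - k by omega)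
    rw [hj]
    exact h j (by omega) (by omega)

theorem norm_pow_seven_lt {s : ℂ} (hs3 : ‖s‖ < 1 / 3) : ‖s ^ 7‖ < 1 / 6 := by
  rw [norm_pow]
  calc ‖s‖ ^ 7 ≤ (1 / 3) ^ 7 := pow_le_pow_left₀ (norm_nonneg s) hs3.le 7
    _ < 1 / 6 := by norm_num

theorem thetaLog7_neg {s : ℂ} (hs : s ≠ 0) (hs3 : ‖s‖ < 1 / 3) {k : ℤ} (hk : theta7 s k ≠ 0) :
    thetaLog7 s (-k) = 1 - thetaLog7 s k := by
  rw [thetaLog7, zpow_neg, jacLog_inv (pow_ne_zero 7 hs) (by linarith [norm_pow_seven_lt hs3])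
    (zpow_ne_zero k (pow_ne_zero 2 hs)) hk, thetaLog7]

theorem thetaLog7_seven_sub {s : ℂ} (hs : s ≠ 0) (hs3 : ‖s‖ < 1 / 3) {k : ℤ}
    (hk : theta7 s k ≠ 0) : thetaLog7 s (7 - k) = -thetaLog7 s k := by
  have hy := zpow_ne_zero k (pow_ne_zero 2 hs)
  have h1 : ‖s ^ 7‖ < 1 := by linarith [norm_pow_seven_lt hs3]
  rw [thetaLog7, pow_two_zpow_seven_sub hs, jacLog_sq_mul (pow_ne_zero 7 hs) h1 (inv_ne_zero hy),
    jacLog_inv (pow_ne_zero 7 hs) h1 hy hk, thetaLog7]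
  · ring
  · rw [jac_inv hy]
    exact mul_ne_zero (neg_ne_zero.2 (inv_ne_zero hy)) hk

theorem weierstrass_theta7 {s : ℂ} (hs : s ≠ 0) (hs3 : ‖s‖ < 1 / 3) (a b c d : ℤ) :
    theta7 s (a + b) * theta7 s (a - b) / (s ^ 2) ^ a *
        (theta7 s (c + d) * theta7 s (c - d) / (s ^ 2) ^ c) -
      theta7 s (a + c) * theta7 s (a - c) / (s ^ 2) ^ a *
        (theta7 s (b + d) * theta7 s (b - d) / (s ^ 2) ^ b) +
      theta7 s (a + d) * theta7 s (a - d) / (s ^ 2) ^ a *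
        (theta7 s (b + c) * theta7 s (b - c) / (s ^ 2) ^ b) = 0 := by
  have hy := pow_ne_zero 2 hs
  simp only [theta7, zpow_add₀ hy, zpow_sub₀ hy]
  exact weierstrass (pow_ne_zero 7 hs) (by linarith [norm_pow_seven_lt hs3]) (zpow_ne_zero a hy)
    (zpow_ne_zero b hy) (zpow_ne_zero c hy) (zpow_ne_zero d hy)

theorem weierstrass_deriv_theta7 {s : ℂ} (hs : s ≠ 0) (hs3 : ‖s‖ < 1 / 3) {b c d : ℤ}
    (h1 : theta7 s (b + c) ≠ 0) (h2 : theta7 s (b - c) ≠ 0) (h3 : theta7 s (b + d) ≠ 0)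
    (h4 : theta7 s (b - d) ≠ 0) :
    deriv (jac (s ^ 7)) 1 * theta7 s (2 * b) *
        (theta7 s (c + d) * theta7 s (c - d) / (s ^ 2) ^ c) =
      theta7 s (b + c) * theta7 s (b - c) * (theta7 s (b + d) * theta7 s (b - d)) / (s ^ 2) ^ b *
        (thetaLog7 s (b + c) + thetaLog7 s (b - c) - thetaLog7 s (b + d) -
          thetaLog7 s (b - d)) := by
  have hy := pow_ne_zero 2 hs
  simp only [theta7, thetaLog7, two_mul, zpow_add₀ hy, zpow_sub₀ hy] at *
  rw [← weierstrass_deriv (pow_ne_zero 7 hs) (by linarith [norm_pow_seven_lt hs3])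
    (zpow_ne_zero b hy) (zpow_ne_zero c hy) (zpow_ne_zero d hy) h1 h2 h3 h4, pow_two ((s ^ 2) ^ b)]

/-- Klein's quartic relation between the theta values of level seven. -/
theorem klein_quartic {s : ℂ} (hs : s ≠ 0) (hs3 : ‖s‖ < 1 / 3) :
    s ^ 2 * theta7 s 2 * theta7 s 1 ^ 3 - theta7 s 3 * theta7 s 2 ^ 3 +
      theta7 s 3 ^ 3 * theta7 s 1 = 0 := by
  have h := weierstrass_theta7 hs hs3 3 2 1 0
  have h5 := theta7_seven_sub hs 2
  have h4 := theta7_seven_sub hs 3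
  norm_num at h h4 h5
  rw [h4, h5] at h
  field_simp at h
  linear_combination h

theorem thetaLog7_formulas {s : ℂ} (hs : s ≠ 0) (hs3 : ‖s‖ < 1 / 3) :
    let a := theta7 s 1
    let b := theta7 s 2
    let c := theta7 s 3
    let D := -deriv (jac (s ^ 7)) 1
    let X := D * c / a ^ 2
    let Y := D * s ^ 2 * a / b ^ 2
    let Z := D * s ^ 2 * b / c ^ 2
    14 * thetaLog7 s 1 = 5 - 5 * X - Y - 3 * Z ∧
      14 * thetaLog7 s 2 = 3 - 3 * X + 5 * Y + Z ∧ 14 * thetaLog7 s 3 = 1 - X - 3 * Y + 5 * Z := by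
  intro a b c D X Y Z
  have hk := klein_quartic hs hs3
  have ha : theta7 s 1 ≠ 0 := theta7_ne_zero hs hs3 (by norm_num) (by norm_num)
  have hb : theta7 s 2 ≠ 0 := theta7_ne_zero hs hs3 (by norm_num) (by norm_num)
  have hc : theta7 s 3 ≠ 0 := theta7_ne_zero hs hs3 (by norm_num) (by norm_num)
  have h5 := theta7_seven_sub hs 2
  have h4 := theta7_seven_sub hs 3
  have h6 := theta7_seven_sub hs 1
  have l5 := thetaLog7_seven_sub hs hs3 hb
  have l4 := thetaLog7_seven_sub hs hs3 hc
  have l1 := thetaLog7_neg hs hs3 ha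
  have n1 := theta7_neg hs 1
  have n2 := theta7_neg hs 2
  have n3 := theta7_neg hs 3
  have l2 := thetaLog7_neg hs hs3 hb
  have l3 := thetaLog7_neg hs hs3 hc
  norm_num at h4 h5 h6 l5 l4
  have e1 := weierstrass_deriv_theta7 hs hs3 (b := 1) (c := 0) (d := 2)
  have e2 := weierstrass_deriv_theta7 hs hs3 (b := 2) (c := 0) (d := 3)
  have e3 := weierstrass_deriv_theta7 hs hs3 (b := 3) (c := 0) (d := 1)
  norm_num [h4, h5, h6, n1, n2, n3, l1, l2, l3, l5, l4, ha, hb, hc, hs] at e1 e2 e3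
  simp only [X, Y, Z, D, a, b, c]
  generalize theta7 s 1 = a at *
  generalize theta7 s 2 = b at *
  generalize theta7 s 3 = c at *
  generalize deriv (jac (s ^ 7)) 1 = D at *
  generalize thetaLog7 s 1 = r1 at *
  generalize thetaLog7 s 2 = r2 at *
  generalize thetaLog7 s 3 = r3 at *
  have f1 : 3 * r1 - r3 - 1 = D * c / a ^ 2 + D * s ^ 2 * b / c ^ 2 := by
    field_simp at e1 ⊢
    refine mul_right_cancel₀ ha ?_
    linear_combination c * e1 - D * hk
  have f2 : 3 * r2 + r1 - 1 = D * c / a ^ 2 - D * s ^ 2 * a / b ^ 2 := by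
    field_simp at e2 ⊢
    refine mul_right_cancel₀ hb ?_
    linear_combination a * e2 + D * hk
  have f3 : 3 * r3 - r2 = D * s ^ 2 * a / b ^ 2 - D * s ^ 2 * b / c ^ 2 := by
    field_simp at e3 ⊢
    refine mul_right_cancel₀ hc ?_
    linear_combination (-b) * e3 - D * s ^ 2 * hk
  refine ⟨?_, ?_, ?_⟩
  · linear_combination (9 / 2) * f1 + (1 / 2) * f2 + (3 / 2) * f3
  · linear_combination (9 / 2) * f2 + (-3 / 2) * f1 + (-1/2) * f3
  · linear_combination (9 / 2) * f3 + (3 / 2) * f2 + (-1 / 2) * f1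

theorem zpow_pow_left (s : ℂ) (a : ℕ) (n : ℤ) : (s ^ a) ^ n = s ^ (a * n : ℤ) := by
  rw [zpow_mul, zpow_natCast]

/-- The theta values `jac (s ^ 21) (y ^ k)` at the points `y ^ k`, with `y = s ^ 2`. -/
noncomputable def theta21 (s : ℂ) (k : ℤ) : ℂ := jac ((s ^ 7) ^ 3) ((s ^ 2) ^ k)

theorem theta21_sub {s : ℂ} (hs : s ≠ 0) (k : ℤ) : theta21 s (21 - k) = theta21 s k := by
  have e : (s ^ 2) ^ (21 - k) = ((s ^ 7) ^ 3) ^ 2 * ((s ^ 2) ^ k)⁻¹ := by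
    rw [zpow_sub₀ (pow_ne_zero 2 hs), div_eq_mul_inv]
    congr 1
    norm_cast
    ring
  rw [theta21, e, jac_sq_mul_inv (pow_ne_zero 3 (pow_ne_zero 7 hs))
    (zpow_ne_zero k (pow_ne_zero 2 hs)), theta21]

theorem theta21_add {s : ℂ} (hs : s ≠ 0) (k : ℤ) :
    theta21 s (21 + k) = -((s ^ 2) ^ k)⁻¹ * theta21 s k := by
  have e : (s ^ 2) ^ (21 + k) = ((s ^ 7) ^ 3) ^ 2 * (s ^ 2) ^ k := by
    rw [zpow_add₀ (pow_ne_zero 2 hs)]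
    congr 1
    norm_cast
    ring
  rw [theta21, e, jac_sq_mul (pow_ne_zero 3 (pow_ne_zero 7 hs))
    (zpow_ne_zero k (pow_ne_zero 2 hs)), theta21]

theorem theta21_seven {s : ℂ} (hs : s ≠ 0) : theta21 s 7 = pent (s ^ 7) := by
  rw [← (jac_cube_sq (s ^ 7) (pow_ne_zero 7 hs)).1, theta21]
  congr 1
  norm_cast
  ring

theorem quintuple_theta21 {s : ℂ} (hs : s ≠ 0) (hs1 : ‖s‖ < 1) (k : ℤ) :
    theta7 s k * (theta21 s (7 + 3 * k) + (s ^ 2) ^ k * theta21 s (14 + 3 * k)) =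
      pent (s ^ 7) * theta7 s (2 * k) := by
  have hy := pow_ne_zero 2 hs
  have h := quintuple_jac (z := (s ^ 2) ^ k) (pow_ne_zero 7 hs)
    (by rw [norm_pow]; exact pow_lt_one₀ (norm_nonneg s) hs1 (by norm_num)) (zpow_ne_zero k hy)
  have e1 : (s ^ 2) ^ (7 + 3 * k) = (s ^ 7) ^ 2 * ((s ^ 2) ^ k) ^ 3 := by
    rw [zpow_add₀ hy, mul_comm 3 k, zpow_mul (s ^ 2) k]
    norm_cast
    ring
  have e2 : (s ^ 2) ^ (14 + 3 * k) = (s ^ 7) ^ 4 * ((s ^ 2) ^ k) ^ 3 := by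
    rw [zpow_add₀ hy, mul_comm 3 k, zpow_mul (s ^ 2) k]
    norm_cast
    ring
  have e3 : (s ^ 2) ^ (2 * k) = ((s ^ 2) ^ k) ^ 2 := by
    rw [mul_comm 2 k, zpow_mul (s ^ 2) k]
    norm_cast
  rw [theta21, theta21, theta7, theta7, e1, e2, e3, h]

theorem pent_eq_sum_theta21 {s : ℂ} (hs : s ≠ 0) (hs1 : ‖s‖ < 1) :
    pent s = ∑ r ∈ Finset.range 7,
      (-1) ^ r * s ^ (r * (3 * r + 1)) * theta21 (s ^ 7) (3 * r + 11) := by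
  have hf : Summable fun n : ℤ => (-1) ^ n * s ^ (n * (3 * n + 1)) := by
    refine Summable.of_norm ((summable_quad hs hs1 one_ne_zero 1 0 (show (0 : ℤ) < 3 by norm_num)
      (fun n => n * (3 * n + 1)) (fun n => by ring)).congr fun n => ?_)
    rw [one_zpow, mul_one, norm_mul, norm_neg_one_zpow, one_mul]
  rw [pent, tsum_int_mod 7 hf]
  refine Finset.sum_congr rfl fun r _ => ?_
  rw [theta21, jac, ← tsum_mul_left]
  refine tsum_congr fun m => ?_
  simp only [← pow_mul, zpow_pow_left, ← zpow_mul]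
  rw [zpow_split hs (show (((7 : ℕ) : ℤ) * m + r) * (3 * (((7 : ℕ) : ℤ) * m + r) + 1) =
    ((r * (3 * r + 1) : ℕ) : ℤ) + ((((7 * 7 * 3 : ℕ) : ℤ) * (m * (m - 1))) +
      (7 * 2 : ℕ) * (3 * r + 11) * m) by push_cast; ring), zpow_add₀ hs, zpow_natCast,
    neg_one_zpow_add, zpow_natCast]
  have : (-1 : ℂ) ^ (((7 : ℕ) : ℤ) * m) = (-1) ^ m := by
    rw [zpow_mul]
    norm_num
  rw [this]
  push_cast
  ring

/-- The seven-term dissection of the pentagonal series. -/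
theorem pent_dissection {s : ℂ} (hs : s ≠ 0) (hs3 : ‖s‖ < 1 / 3) :
    let a := theta7 (s ^ 7) 1
    let b := theta7 (s ^ 7) 2
    let c := theta7 (s ^ 7) 3
    pent s = pent ((s ^ 7) ^ 7) * (b / a - s ^ 2 * (c / b) - s ^ 4 + s ^ 10 * (a / c)) := by
  intro a b c
  have hσ := pow_ne_zero 7 hs
  have hσ3 : ‖s ^ 7‖ < 1 / 3 := by linarith [norm_pow_seven_lt hs3]
  have ha : a ≠ 0 := theta7_ne_zero hσ hσ3 (by norm_num) (by norm_num)
  have hb : b ≠ 0 := theta7_ne_zero hσ hσ3 (by norm_num) (by norm_num)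
  have hc : c ≠ 0 := theta7_ne_zero hσ hσ3 (by norm_num) (by norm_num)
  have q1 := quintuple_theta21 hσ (by linarith) 1
  have q2 := quintuple_theta21 hσ (by linarith) 2
  have q3 := quintuple_theta21 hσ (by linarith) 3
  have t4 := theta7_seven_sub hσ 3
  have t6 := theta7_seven_sub hσ 1
  have u11 := theta21_sub hσ 11
  have u14 := theta21_sub hσ 14
  have u16 := theta21_sub hσ 16
  have u29 := theta21_add hσ 8
  have u8 := theta21_sub hσ 8
  have u26 := theta21_add hσ 5
  have h7 := theta21_seven hσ
  rw [pent_eq_sum_theta21 hs (by linarith)]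
  simp only [Finset.sum_range_succ, Finset.sum_range_zero]
  norm_num at q1 q2 q3 t4 t6 u11 u14 u16 u29 u8 u26 h7 ⊢
  rw [mul_comm (theta7 _ 1), ← eq_div_iff ha] at q1
  rw [mul_comm (theta7 _ 2), ← eq_div_iff hb, t4] at q2
  rw [mul_comm (theta7 _ 3), ← eq_div_iff hc, t6] at q3
  have i5 : (((s ^ 7) ^ 2) ^ 5)⁻¹ * s ^ 80 = s ^ 10 := by field_simp
  have i8 : (((s ^ 7) ^ 2) ^ 8)⁻¹ * s ^ 114 = s ^ 2 := by field_simp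
  rw [u26, u16, u29, ← u8, ← u14, h7, ← u11]
  simp only [a, b, c]
  linear_combination q1 - s ^ 2 * q2 + s ^ 10 * q3 + theta21 (s ^ 7) 16 * i5 -
    theta21 (s ^ 7) 13 * i8

/-- The series governing partition ranks modulo seven, in terms of `q = s ^ 2`. The term `n = 0` is
omitted, its denominator being zero. -/
noncomputable def rankSeries (s : ℂ) (b : ℤ) : ℂ :=
  ∑' n : ℤ, (-1) ^ n * s ^ (n * (3 * n + 1) + 2 * b * n) / (1 - s ^ (14 * n))

theorem half_le_norm_one_sub {x : ℂ} (hx : ‖x‖ ≤ 1 / 2) : 1 / 2 ≤ ‖1 - x‖ := by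
  have := norm_sub_norm_le 1 x
  rw [norm_one] at this
  linarith

theorem norm_inv_one_sub_zpow_le {s : ℂ} (hs3 : ‖s‖ < 1 / 3) (n : ℤ) :
    ‖(1 - s ^ (14 * n))⁻¹‖ ≤ 2 := by
  have hpow : ∀ m : ℤ, 0 < m → ‖s ^ (14 * m)‖ ≤ 1 / 2 := by
    intro m hm
    obtain ⟨k, hk⟩ := Int.eq_ofNat_of_zero_le (show 0 ≤ 14 * m by omega)
    rw [hk, zpow_natCast, norm_pow]
    calc ‖s‖ ^ k ≤ ‖s‖ ^ 1 := pow_le_pow_of_le_one (norm_nonneg s) (by linarith) (by omega)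
      _ ≤ 1 / 2 := by linarith
  rw [norm_inv]
  rcases lt_trichotomy n 0 with hn | rfl | hn
  · have h := hpow (-n) (by omega)
    rw [mul_neg, zpow_neg, norm_inv] at h
    have h0 : 2 ≤ ‖s ^ (14 * n)‖ ∨ ‖s ^ (14 * n)‖ = 0 := by
      rcases (norm_nonneg (s ^ (14 * n))).eq_or_lt with h0 | h0
      · exact Or.inr h0.symm
      · left
        rw [inv_le_comm₀ h0 (by norm_num)] at h
        linarith
    refine (inv_anti₀ (by norm_num) (?_ : (1 / 2 : ℝ) ≤ _)).trans (by norm_num)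
    rcases h0 with h0 | h0
    · have := norm_sub_norm_le (s ^ (14 * n)) 1
      rw [norm_one, norm_sub_rev] at this
      linarith
    · exact half_le_norm_one_sub (by rw [h0]; norm_num)
  · simp
  · exact (inv_anti₀ (by norm_num) (half_le_norm_one_sub (hpow n hn))).trans (by norm_num)

theorem summable_rankSeries_num {s : ℂ} (hs : s ≠ 0) (hs1 : ‖s‖ < 1) (b : ℤ) :
    Summable fun n : ℤ => ‖(-1) ^ n * s ^ (n * (3 * n + 1) + 2 * b * n)‖ :=
  (summable_quad hs hs1 one_ne_zero (1 + 2 * b) 0 (show (0 : ℤ) < 3 by norm_num)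
    (fun n => n * (3 * n + 1) + 2 * b * n) (fun n => by ring)).congr fun n => by
      rw [one_zpow, mul_one, norm_mul, norm_neg_one_zpow, one_mul]

theorem summable_rankSeries {s : ℂ} (hs : s ≠ 0) (hs3 : ‖s‖ < 1 / 3) (b : ℤ) :
    Summable fun n : ℤ => (-1) ^ n * s ^ (n * (3 * n + 1) + 2 * b * n) / (1 - s ^ (14 * n)) := by
  refine Summable.of_norm_bounded ((summable_rankSeries_num hs (by linarith) b).mul_right 2)
    fun n => ?_
  rw [div_eq_mul_inv, norm_mul]
  gcongr
  exact norm_inv_one_sub_zpow_le hs3 n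

theorem rankSeries_six_sub {s : ℂ} (hs : s ≠ 0) (b : ℤ) :
    rankSeries s (6 - b) = -rankSeries s b := by
  rw [rankSeries, rankSeries, ← tsum_neg, ← (Equiv.neg ℤ).tsum_eq]
  refine tsum_congr fun n => ?_
  have h := zpow_ne_zero (14 * n) hs
  rw [Equiv.neg_apply, neg_one_zpow_neg, mul_neg 14 n, zpow_neg,
    zpow_split hs (show n * (3 * n + 1) + 2 * b * n =
      -n * (3 * -n + 1) + 2 * (6 - b) * -n + 14 * n by ring)]
  by_cases h1 : 1 - s ^ (14 * n) = 0
  · have : s ^ (14 * n) = 1 := (sub_eq_zero.1 h1).symm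
    simp [this]
  · have h2 : 1 - (s ^ (14 * n))⁻¹ ≠ 0 := by
      intro h2
      refine h1 ?_
      rw [sub_eq_zero] at h2 ⊢
      rw [← inv_inv (s ^ (14 * n)), ← h2, inv_one]
    have h3 : s ^ (14 * n) - 1 ≠ 0 := by rw [← neg_sub, neg_ne_zero]; exact h1
    field_simp
    ring

theorem rankSeries_sub_add_seven {s : ℂ} (hs : s ≠ 0) (hs3 : ‖s‖ < 1 / 3) :
    rankSeries s 0 - rankSeries s 7 = pent s - 1 := by
  have hp := (summable_rankSeries_num hs (by linarith) 0).of_norm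
  rw [rankSeries, rankSeries,
    ← (summable_rankSeries hs hs3 0).tsum_sub (summable_rankSeries hs hs3 7)]
  simp only [mul_zero, zero_mul, add_zero] at hp ⊢
  refine Eq.trans ?_ (hp.hasSum.sub (hasSum_ite_eq (0 : ℤ) (1 : ℂ))).tsum_eq
  refine tsum_congr fun n => ?_
  rcases eq_or_ne n 0 with rfl | hn
  · simp
  · have h := one_sub_zpow_ne_zero (by linarith : ‖s‖ < 1) (n := 7 * n) (by omega)
    rw [← mul_assoc] at h
    norm_num at h
    rw [if_neg hn, zpow_split hs
      (show n * (3 * n + 1) + 2 * 7 * n = n * (3 * n + 1) + 14 * n by ring)]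
    field_simp
    ring

/-- The Appell–Lerch series at the seventh-order points `y ^ k`, with `y = s ^ 2`. -/
noncomputable def lerch7 (s : ℂ) (j k : ℤ) : ℂ := lerch (s ^ 7) ((s ^ 2) ^ (3 * j)) ((s ^ 2) ^ k)

theorem rankSeries_eq_sum_lerch7 {s : ℂ} (hs : s ≠ 0) (hs3 : ‖s‖ < 1 / 3) (d : ℤ) :
    rankSeries s (10 - 3 * d) = ∑ r ∈ Finset.range 7, (-1) ^ (r + d - 3) *
      s ^ ((r + d - 3) * (3 * (r + d - 3) + 21 - 6 * d)) * lerch7 (s ^ 7) (r - 3) (r + d - 3) := by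
  have hf := summable_rankSeries hs hs3 (10 - 3 * d)
  rw [rankSeries, ← (Equiv.addRight (d - 3)).tsum_eq]
  refine (tsum_int_mod 7 ((Equiv.addRight (d - 3)).summable_iff.2 hf)).trans ?_
  refine Finset.sum_congr rfl fun r _ => ?_
  rw [lerch7, lerch, ← tsum_mul_left]
  refine tsum_congr fun m => ?_
  simp only [← pow_mul, zpow_pow_left, ← zpow_mul, Function.comp, Equiv.coe_addRight]
  have e1 : (-1 : ℂ) ^ (((7 : ℕ) : ℤ) * m + r + (d - 3)) = (-1) ^ (r + d - 3) * (-1) ^ m := by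
    rw [show ((7 : ℕ) : ℤ) * m + r + (d - 3) = (r + d - 3) + (m + 2 * (3 * m)) by push_cast; ring,
      neg_one_zpow_add, neg_one_zpow_add m, neg_one_zpow_two_mul, mul_one]
  have e2 : (((7 : ℕ) : ℤ) * m + r + (d - 3)) * (3 * (((7 : ℕ) : ℤ) * m + r + (d - 3)) + 1) +
      2 * (10 - 3 * d) * (((7 : ℕ) : ℤ) * m + r + (d - 3)) =
      (r + d - 3) * (3 * (r + d - 3) + 21 - 6 * d) +
      (((7 * 7 : ℕ) : ℤ) * (3 * m * (m + 1)) + ((7 * 2 : ℕ) : ℤ) * (3 * (r - 3)) * m) := by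
    push_cast
    ring
  have e3 : 14 * (((7 : ℕ) : ℤ) * m + r + (d - 3)) =
      ((7 * 2 : ℕ) : ℤ) * (r + d - 3) + ((7 * 7 : ℕ) : ℤ) * (2 * m) := by
    push_cast
    ring
  rw [e1, e2, e3, zpow_add₀ hs, zpow_add₀ hs, zpow_add₀ hs]
  ring

theorem lerch7_three_term {s : ℂ} (hs : s ≠ 0) (hs3 : ‖s‖ < 1 / 3) {c d : ℤ}
    (hc : theta7 s c ≠ 0) (hd : theta7 s d ≠ 0) (hdc : theta7 s (d + c) ≠ 0)
    (hdc' : theta7 s (d - c) ≠ 0) :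
    lerch7 s (-c) (d - c) + (s ^ 2) ^ (3 * c) * lerch7 s c (d + c) =
      (s ^ 2) ^ c * (theta7 s (2 * c) / theta7 s c) * lerch7 s 0 d +
        -deriv (jac (s ^ 7)) 1 * theta7 s c * theta7 s (2 * c) /
          (theta7 s (d - c) * theta7 s d * theta7 s (d + c)) := by
  have hy := pow_ne_zero 2 hs
  have e3 : ∀ k : ℤ, (s ^ 2) ^ (3 * k) = ((s ^ 2) ^ k) ^ 3 := fun k => by
    rw [mul_comm, zpow_mul]; norm_cast
  have e2 : (s ^ 2) ^ (2 * c) = ((s ^ 2) ^ c) ^ 2 := by rw [mul_comm, zpow_mul]; norm_cast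
  simp only [theta7, lerch7, e3, e2, zpow_add₀ hy, zpow_sub₀ hy, zpow_neg, div_eq_mul_inv,
    zpow_zero, one_pow] at *
  simpa only [div_eq_mul_inv] using lerch_three_term (pow_ne_zero 7 hs)
    (by linarith [norm_pow_seven_lt hs3]) (zpow_ne_zero c hy) (zpow_ne_zero d hy) hc hd hdc hdc'

theorem lerch7_three_term_pole {s : ℂ} (hs : s ≠ 0) (hs3 : ‖s‖ < 1 / 3) {d : ℤ}
    (hd : theta7 s d ≠ 0) (hd2 : theta7 s (2 * d) ≠ 0) :
    lerch7 s (-d) 0 + (s ^ 2) ^ (3 * d) * lerch7 s d (2 * d) =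
      (s ^ 2) ^ d * (theta7 s (2 * d) / theta7 s d) * lerch7 s 0 d +
        thetaLog7 s d + thetaLog7 s (2 * d) := by
  have hy := pow_ne_zero 2 hs
  have e3 : ∀ k : ℤ, (s ^ 2) ^ (3 * k) = ((s ^ 2) ^ k) ^ 3 := fun k => by
    rw [mul_comm, zpow_mul]; norm_cast
  have e2 : (s ^ 2) ^ (2 * d) = ((s ^ 2) ^ d) ^ 2 := by rw [mul_comm, zpow_mul]; norm_cast
  have h6 := norm_pow_seven_lt hs3
  simp only [theta7, thetaLog7, lerch7, e3, e2, zpow_neg, zpow_zero, one_pow] at *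
  exact lerch_three_term_pole (pow_ne_zero 7 hs) (by linarith) (zpow_ne_zero d hy) hd hd2
    (deriv_jac_one_ne_zero (pow_ne_zero 7 hs) h6)

/-- Multiplying out the dissected pentagonal series on Klein's quartic. -/
theorem klein_product {s a b c : ℂ} (ha : a ≠ 0) (hb : b ≠ 0) (hc : c ≠ 0)
    (hk : s ^ 14 * b * a ^ 3 - c * b ^ 3 + c ^ 3 * a = 0) (f0 f1 f3 f4 : ℂ) :
    (b / a - s ^ 2 * (c / b) - s ^ 4 + s ^ 10 * (a / c)) *
      (f0 * (c / (a * b)) + f1 * (s ^ 2 / a) + (f0 + f1) * (s ^ 4 * b / (a * c)) +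
        f3 * (s ^ 6 / b) + f4 * (s ^ 8 / c) + (f0 + f3) * (s ^ 12 * a / (b * c))) =
      f0 * (c / a ^ 2) - (f0 + f3) * (s ^ 14 * a / b ^ 2) + (f0 + f1) * (s ^ 14 * b / c ^ 2) +
        (f1 - f0) * (s ^ 2 * b / a ^ 2) + (f3 - f0 - 2 * f1) * (s ^ 6 / a) +
        (f4 - f0 - f1 - f3) * (s ^ 8 * b / (a * c)) + (f0 - f3 - f4) * (s ^ 10 / b) +
        (f0 + f3 - f4 + f1) * (s ^ 12 / c) + (f4 + f0 + f1) * (s ^ 18 * a / c ^ 2) +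
        (f0 + 2 * f3) * (s ^ 22 * a ^ 2 / (b * c ^ 2)) := by
  field_simp
  linear_combination (-(f0 * s ^ 2 * c + (f0 + f1) * s ^ 4 * b + f3 * s ^ 8 * a)) * hk

/-- The combinations of theta quotients that are supported on six residue classes modulo seven. -/
noncomputable def thetaPart (s f0 f1 f3 f4 : ℂ) : ℂ :=
  -deriv (jac ((s ^ 7) ^ 7)) 1 *
    (f0 * (theta7 (s ^ 7) 3 / (theta7 (s ^ 7) 1 * theta7 (s ^ 7) 2)) +
      f1 * (s ^ 2 / theta7 (s ^ 7) 1) +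
      (f0 + f1) * (s ^ 4 * theta7 (s ^ 7) 2 / (theta7 (s ^ 7) 1 * theta7 (s ^ 7) 3)) +
      f3 * (s ^ 6 / theta7 (s ^ 7) 2) + f4 * (s ^ 8 / theta7 (s ^ 7) 3) +
      (f0 + f3) * (s ^ 12 * theta7 (s ^ 7) 1 / (theta7 (s ^ 7) 2 * theta7 (s ^ 7) 3)))

theorem rankSeries_seven {s : ℂ} (hs : s ≠ 0) (hs3 : ‖s‖ < 1 / 3) :
    7 * rankSeries s 7 - 4 = pent s / pent ((s ^ 7) ^ 7) *
      (7 * s ^ 14 * lerch7 (s ^ 7) 0 1 + thetaPart s (-4) 3 2 1) := by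
  have hσ := pow_ne_zero 7 hs
  have hσ3 : ‖s ^ 7‖ < 1 / 3 := by linarith [norm_pow_seven_lt hs3]
  have hJ : pent ((s ^ 7) ^ 7) ≠ 0 :=
    pent_ne_zero (by linarith [norm_pow_seven_lt hσ3])
  have ha : theta7 (s ^ 7) 1 ≠ 0 := theta7_ne_zero hσ hσ3 (by norm_num) (by norm_num)
  have hb : theta7 (s ^ 7) 2 ≠ 0 := theta7_ne_zero hσ hσ3 (by norm_num) (by norm_num)
  have hc : theta7 (s ^ 7) 3 ≠ 0 := theta7_ne_zero hσ hσ3 (by norm_num) (by norm_num)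
  have hk := klein_quartic hσ hσ3
  obtain ⟨r1, r2, r3⟩ := thetaLog7_formulas hσ hσ3
  have t4 := theta7_seven_sub hσ 3
  have t6 := theta7_seven_sub hσ 1
  have n1 := theta7_neg hσ 1
  have n2 := theta7_neg hσ 2
  have hE : pent s / pent ((s ^ 7) ^ 7) = _ :=
    (div_eq_iff hJ).2 ((pent_dissection hs hs3).trans (mul_comm _ _))
  have h := rankSeries_eq_sum_lerch7 hs hs3 1
  have p1 := lerch7_three_term_pole hσ hσ3 (d := 1)
  have p2 := lerch7_three_term hσ hσ3 (c := 2) (d := 1)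
  have p3 := lerch7_three_term hσ hσ3 (c := 3) (d := 1)
  simp only [Finset.sum_range_succ, Finset.sum_range_zero] at h
  norm_num [ha, hb, hc, hs] at h p1 p2 p3 t4 t6 n1 n2 hk
  norm_num [ha, hb, hc, hs, t4, t6, n1, n2] at p2 p3
  rw [hE, thetaPart]
  generalize theta7 (s ^ 7) 1 = a at *
  generalize theta7 (s ^ 7) 2 = b at *
  generalize theta7 (s ^ 7) 3 = c at *
  generalize deriv (jac ((s ^ 7) ^ 7)) 1 = D at *
  have key := klein_product (s := s) ha hb hc (by linear_combination hk) (-4) 3 2 1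
  have i1 : (s ^ 12)⁻¹ * s ^ 84 = s ^ 72 := by field_simp
  have i2 : (s ^ 18)⁻¹ * s ^ 126 = s ^ 108 := by field_simp
  have i3 : (s ^ 12)⁻¹ * s ^ 28 = s ^ 16 := by field_simp
  have i4 : (s ^ 18)⁻¹ * s ^ 42 = s ^ 24 := by field_simp
  have q2 : (s ^ 12)⁻¹ * (D * b * c / (((s ^ 7) ^ 2)⁻¹ * a * a * c)) = D * (s ^ 2 * b / a ^ 2) := by
    field_simp
  have q3 : (s ^ 18)⁻¹ * (D * c * a / ((((s ^ 7) ^ 2) ^ 2)⁻¹ * b * a * c)) = D * (s ^ 10 / b) := by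
    field_simp
  linear_combination 7 * h + 7 * p1 - 7 * (s ^ 12)⁻¹ * p2 + 7 * (s ^ 18)⁻¹ * p3 + (r1 + r2) / 2 +
    D * key + 7 * lerch7 (s ^ 7) 2 3 * i1 - 7 * lerch7 (s ^ 7) 3 4 * i2 - 7 * q2 + 7 * q3 -
    7 * (c / b) * lerch7 (s ^ 7) 0 1 * i3 + 7 * (a / c) * lerch7 (s ^ 7) 0 1 * i4

theorem rankSeries_four {s : ℂ} (hs : s ≠ 0) (hs3 : ‖s‖ < 1 / 3) :
    7 * rankSeries s 4 - 1 = pent s / pent ((s ^ 7) ^ 7) *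
      (-7 * s ^ 26 * lerch7 (s ^ 7) 0 2 + thetaPart s (-1) (-1) (-3) 2) := by
  have hσ := pow_ne_zero 7 hs
  have hσ3 : ‖s ^ 7‖ < 1 / 3 := by linarith [norm_pow_seven_lt hs3]
  have hJ : pent ((s ^ 7) ^ 7) ≠ 0 :=
    pent_ne_zero (by linarith [norm_pow_seven_lt hσ3])
  have ha : theta7 (s ^ 7) 1 ≠ 0 := theta7_ne_zero hσ hσ3 (by norm_num) (by norm_num)
  have hb : theta7 (s ^ 7) 2 ≠ 0 := theta7_ne_zero hσ hσ3 (by norm_num) (by norm_num)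
  have hc : theta7 (s ^ 7) 3 ≠ 0 := theta7_ne_zero hσ hσ3 (by norm_num) (by norm_num)
  have hk := klein_quartic hσ hσ3
  obtain ⟨r1, r2, r3⟩ := thetaLog7_formulas hσ hσ3
  have t4 := theta7_seven_sub hσ 3
  have t5 := theta7_seven_sub hσ 2
  have t6 := theta7_seven_sub hσ 1
  have l4 := thetaLog7_seven_sub hσ hσ3 hc
  have n1 := theta7_neg hσ 1
  have hE : pent s / pent ((s ^ 7) ^ 7) = _ :=
    (div_eq_iff hJ).2 ((pent_dissection hs hs3).trans (mul_comm _ _))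
  have h := rankSeries_eq_sum_lerch7 hs hs3 2
  have p2 := lerch7_three_term_pole hσ hσ3 (d := 2)
  have p1 := lerch7_three_term hσ hσ3 (c := 1) (d := 2)
  have p3 := lerch7_three_term hσ hσ3 (c := 3) (d := 2)
  simp only [Finset.sum_range_succ, Finset.sum_range_zero] at h
  norm_num [ha, hb, hc, hs] at h p1 p2 p3 t4 t5 t6 n1 hk l4
  norm_num [ha, hb, hc, hs, t4, t5, t6, n1, l4] at p1 p2 p3
  rw [hE, thetaPart]
  generalize theta7 (s ^ 7) 1 = a at *
  generalize theta7 (s ^ 7) 2 = b at *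
  generalize theta7 (s ^ 7) 3 = c at *
  generalize deriv (jac ((s ^ 7) ^ 7)) 1 = D at *
  have key := klein_product (s := s) ha hb hc (by linear_combination hk) (-1) (-1) (-3) 2
  have i1 : (s ^ 6)⁻¹ * s ^ 126 = s ^ 120 := by field_simp
  have i2 : (s ^ 6)⁻¹ * s ^ 42 = s ^ 36 := by field_simp
  have q1 : D * a * b / (a * b * c) = D * (1 / c) := by field_simp
  have q3 : (s ^ 6)⁻¹ * (D * c * a / (((s ^ 7) ^ 2)⁻¹ * a * b * b)) =
      D * (s ^ 8 * b / (a * c) - s ^ 22 * a ^ 2 / (b * c ^ 2)) := by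
    field_simp
    linear_combination D * hk
  linear_combination 7 * h + 7 * p2 - 7 * s ^ 12 * p1 - 7 * (s ^ 6)⁻¹ * p3 + (r2 - r3) / 2 +
    D * key + 7 * s ^ 12 * q1 - 7 * q3 + 7 * lerch7 (s ^ 7) 3 5 * i1 -
    7 * (a / c) * lerch7 (s ^ 7) 0 2 * i2

theorem rankSeries_one {s : ℂ} (hs : s ≠ 0) (hs3 : ‖s‖ < 1 / 3) :
    7 * rankSeries s 1 + 2 = pent s / pent ((s ^ 7) ^ 7) *
      (7 * s ^ 32 * lerch7 (s ^ 7) 0 3 + thetaPart s 2 2 (-1) 3) := by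
  have hσ := pow_ne_zero 7 hs
  have hσ3 : ‖s ^ 7‖ < 1 / 3 := by linarith [norm_pow_seven_lt hs3]
  have hJ : pent ((s ^ 7) ^ 7) ≠ 0 :=
    pent_ne_zero (by linarith [norm_pow_seven_lt hσ3])
  have ha : theta7 (s ^ 7) 1 ≠ 0 := theta7_ne_zero hσ hσ3 (by norm_num) (by norm_num)
  have hb : theta7 (s ^ 7) 2 ≠ 0 := theta7_ne_zero hσ hσ3 (by norm_num) (by norm_num)
  have hc : theta7 (s ^ 7) 3 ≠ 0 := theta7_ne_zero hσ hσ3 (by norm_num) (by norm_num)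
  have hk := klein_quartic hσ hσ3
  obtain ⟨r1, r2, r3⟩ := thetaLog7_formulas hσ hσ3
  have t4 := theta7_seven_sub hσ 3
  have t5 := theta7_seven_sub hσ 2
  have t6 := theta7_seven_sub hσ 1
  have l6 := thetaLog7_seven_sub hσ hσ3 ha
  have hE : pent s / pent ((s ^ 7) ^ 7) = _ :=
    (div_eq_iff hJ).2 ((pent_dissection hs hs3).trans (mul_comm _ _))
  have h := rankSeries_eq_sum_lerch7 hs hs3 3
  have p3 := lerch7_three_term_pole hσ hσ3 (d := 3)
  have p1 := lerch7_three_term hσ hσ3 (c := 1) (d := 3)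
  have p2 := lerch7_three_term hσ hσ3 (c := 2) (d := 3)
  simp only [Finset.sum_range_succ, Finset.sum_range_zero] at h
  norm_num [ha, hb, hc, hs] at h p1 p2 p3 t4 t5 t6 hk l6
  norm_num [ha, hb, hc, hs, t4, t5, t6, l6] at p1 p2 p3
  rw [hE, thetaPart]
  generalize theta7 (s ^ 7) 1 = a at *
  generalize theta7 (s ^ 7) 2 = b at *
  generalize theta7 (s ^ 7) 3 = c at *
  generalize deriv (jac ((s ^ 7) ^ 7)) 1 = D at *
  have key := klein_product (s := s) ha hb hc (by linear_combination hk) 2 2 (-1) 3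
  have q1 : D * a * b / (b * c * c) = D * (a / c ^ 2) := by field_simp
  have q2 : D * b * c / (a * c * b) = D * (1 / a) := by field_simp
  linear_combination 7 * h + 7 * p3 - 7 * s ^ 6 * p2 + 7 * s ^ 18 * p1 + (r3 - r1) / 2 +
    D * key - 7 * s ^ 18 * q1 + 7 * s ^ 6 * q2

/-- Discard the largest part and add one to each of `sup - m - 1` parts. -/
def stripMultiset (m : ℤ) (l : Multiset ℕ) : Multiset ℕ :=
  (l.erase l.sup +
    Multiset.replicate ((l.sup : ℤ) - m - 1 - (l.erase l.sup).card).toNat 0).map (· + 1)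

/-- Subtract one from each part and insert a part equal to `m + 1` plus the number of parts. -/
def insertMultiset (m : ℤ) (l : Multiset ℕ) : Multiset ℕ :=
  ((l.card + m + 1 : ℤ).toNat ::ₘ l.map (· - 1)).filter (· ≠ 0)

theorem Multiset.sup_mem_of_ne_zero {l : Multiset ℕ} (hl : l ≠ 0) : l.sup ∈ l := by
  induction l using Multiset.induction_on with
  | empty => exact absurd rfl hl
  | cons a l ih =>
    rw [Multiset.sup_cons]
    by_cases h : l = 0
    · simp [h]
    · rcases le_total a l.sup with h1 | h1
      · rw [sup_eq_right.2 h1]; exact Multiset.mem_cons_of_mem (ih h)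
      · rw [sup_eq_left.2 h1]; exact Multiset.mem_cons_self _ _

theorem Multiset.sup_cons_erase_sup_filter (l : Multiset ℕ) (h0 : ∀ x ∈ l, x ≠ 0) :
    (l.sup ::ₘ l.erase l.sup).filter (· ≠ 0) = l := by
  by_cases h : l = 0
  · simp [h]
  · rw [Multiset.cons_erase (Multiset.sup_mem_of_ne_zero h), Multiset.filter_eq_self]
    exact h0

theorem Multiset.filter_add_replicate_zero (l : Multiset ℕ) :
    l.filter (· ≠ 0) + Multiset.replicate (l.card - (l.filter (· ≠ 0)).card) 0 = l := by
  have h := Multiset.filter_add_not (p := (· ≠ 0)) l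
  have h2 : l.filter (fun x => ¬ x ≠ 0) =
      Multiset.replicate (l.filter (fun x => ¬ x ≠ 0)).card 0 := by
    rw [Multiset.eq_replicate_card]
    intro b hb
    simpa using (Multiset.mem_filter.1 hb).2
  have h3 := congrArg Multiset.card h
  rw [Multiset.card_add] at h3
  conv_rhs => rw [← h]
  rw [h2]
  congr 2
  omega

theorem card_stripMultiset {m : ℤ} {l : Multiset ℕ}
    (h : ((l.erase l.sup).card : ℤ) ≤ (l.sup : ℤ) - m - 1) :
    ((stripMultiset m l).card : ℤ) = (l.sup : ℤ) - m - 1 := by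
  simp only [stripMultiset, Multiset.card_map, Multiset.card_add, Multiset.card_replicate]
  omega

theorem sum_erase_sup (l : Multiset ℕ) : (l.sup + (l.erase l.sup).sum : ℕ) = l.sum := by
  by_cases hl : l = 0
  · simp [hl]
  · rw [← Multiset.sum_cons, Multiset.cons_erase (Multiset.sup_mem_of_ne_zero hl)]

theorem sum_stripMultiset {m : ℤ} {l : Multiset ℕ}
    (h : ((l.erase l.sup).card : ℤ) ≤ (l.sup : ℤ) - m - 1) :
    ((stripMultiset m l).sum : ℤ) = l.sum - m - 1 := by
  have h1 := card_stripMultiset h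
  have h2 := sum_erase_sup l
  have e : (stripMultiset m l).sum = (l.erase l.sup).sum + (stripMultiset m l).card := by
    simp [stripMultiset, Multiset.sum_map_add, add_assoc]
  omega

theorem sum_map_pred (l : Multiset ℕ) (h0 : ∀ x ∈ l, 0 < x) :
    (l.map (· - 1)).sum + l.card = l.sum := by
  induction l using Multiset.induction_on with
  | empty => simp
  | cons a l ih =>
    have := ih fun x hx => h0 x (Multiset.mem_cons_of_mem hx)
    have := h0 a (Multiset.mem_cons_self _ _)
    simp
    omega

theorem sum_insertMultiset {m : ℤ} {l : Multiset ℕ} (h0 : ∀ x ∈ l, 0 < x)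
    (h : 0 ≤ l.card + m + 1) :
    ((insertMultiset m l).sum : ℤ) = l.sum + m + 1 := by
  have h2 := sum_map_pred l h0
  have h3 := Multiset.filter_add_replicate_zero ((l.card + m + 1 : ℤ).toNat ::ₘ l.map (· - 1))
  have h4 := congrArg Multiset.sum h3
  rw [Multiset.sum_add, Multiset.sum_replicate, Multiset.sum_cons, smul_zero, add_zero] at h4
  rw [insertMultiset]
  omega

theorem insertMultiset_stripMultiset {m : ℤ} {l : Multiset ℕ} (h0 : ∀ x ∈ l, 0 < x)
    (h : ((l.erase l.sup).card : ℤ) ≤ (l.sup : ℤ) - m - 1) :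
    insertMultiset m (stripMultiset m l) = l := by
  have h1 := card_stripMultiset h
  rw [insertMultiset, show ((stripMultiset m l).card : ℤ) + m + 1 = l.sup by omega,
    Int.toNat_natCast]
  rw [stripMultiset, Multiset.map_map]
  simp only [Function.comp_def, Nat.add_sub_cancel, Multiset.map_id']
  rw [← Multiset.cons_add, Multiset.filter_add,
    Multiset.sup_cons_erase_sup_filter l fun x hx => (h0 x hx).ne',
    Multiset.filter_eq_nil.2 fun a ha => not_not.2 (Multiset.eq_of_mem_replicate ha), add_zero]

theorem sup_insertMultiset {m : ℤ} {l : Multiset ℕ} (h : ∀ x ∈ l, (x : ℤ) ≤ l.card + m + 2)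
    (hc : 0 ≤ l.card + m + 1) : ((insertMultiset m l).sup : ℤ) = l.card + m + 1 := by
  have h1 : (insertMultiset m l).sup ≤ (l.card + m + 1 : ℤ).toNat := by
    rw [Multiset.sup_le]
    intro b hb
    have hb := (Multiset.mem_filter.1 hb).1
    rcases Multiset.mem_cons.1 hb with rfl | hb
    · exact le_rfl
    · obtain ⟨x, hx, rfl⟩ := Multiset.mem_map.1 hb
      have := h x hx
      omega
  have h2 : (l.card + m + 1 : ℤ).toNat ≤ (insertMultiset m l).sup := by
    rcases Nat.eq_zero_or_pos (l.card + m + 1 : ℤ).toNat with h0 | h0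
    · omega
    · apply Multiset.le_sup
      rw [insertMultiset, Multiset.mem_filter]
      exact ⟨Multiset.mem_cons_self _ _, h0.ne'⟩
  omega

theorem erase_sup_insertMultiset {m : ℤ} {l : Multiset ℕ}
    (h : ∀ x ∈ l, (x : ℤ) ≤ l.card + m + 2) (hc : 0 ≤ l.card + m + 1) :
    (insertMultiset m l).erase (insertMultiset m l).sup = (l.map (· - 1)).filter (· ≠ 0) := by
  have h1 := sup_insertMultiset h hc
  have h2 : (insertMultiset m l).sup = (l.card + m + 1 : ℤ).toNat := by omega
  rw [h2, insertMultiset]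
  by_cases h3 : (l.card + m + 1 : ℤ).toNat = 0
  · rw [h3, Multiset.erase_of_notMem (by simp)]
    simp
  · rw [Multiset.filter_cons_of_pos (p := fun x : ℕ => x ≠ 0) _ h3, Multiset.erase_cons_head]

theorem stripMultiset_insertMultiset {m : ℤ} {l : Multiset ℕ} (h0 : ∀ x ∈ l, 0 < x)
    (h : ∀ x ∈ l, (x : ℤ) ≤ l.card + m + 2) (hc : 0 ≤ l.card + m + 1) :
    stripMultiset m (insertMultiset m l) = l := by
  have h1 := sup_insertMultiset h hc
  rw [stripMultiset, erase_sup_insertMultiset h hc, h1]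
  have h3 := Multiset.filter_add_replicate_zero (l.map (· - 1))
  rw [show (l.card + m + 1 - m - 1 - ((l.map (· - 1)).filter (· ≠ 0)).card : ℤ).toNat =
    (l.map (· - 1)).card - ((l.map (· - 1)).filter (· ≠ 0)).card by
      rw [Multiset.card_map]; omega, h3, Multiset.map_map]
  conv_rhs => rw [← Multiset.map_id l]
  refine Multiset.map_congr rfl fun x hx => ?_
  have := h0 x hx
  simp
  omega

theorem Nat.Partition.rank_le_of_mem {n : ℕ} (P : n.Partition) {m : ℤ} (h : partitionRank P ≤ m) :
    ∀ x ∈ P.parts, (x : ℤ) ≤ P.parts.card + m := by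
  intro x hx
  have := Multiset.le_sup hx
  rw [partitionRank] at h
  omega

theorem Nat.Partition.card_erase_sup_le {n : ℕ} (P : n.Partition) {m : ℤ} {N : ℕ}
    (hn : (n : ℤ) = N + m + 1) (h : m ≤ partitionRank P) :
    ((P.parts.erase P.parts.sup).card : ℤ) ≤ (P.parts.sup : ℤ) - m - 1 := by
  rw [partitionRank] at h
  by_cases h0 : P.parts = 0
  · have := P.parts_sum
    rw [h0] at this h ⊢
    simp at this h ⊢
    omega
  · have := Multiset.card_erase_add_one (Multiset.sup_mem_of_ne_zero h0)
    omega

theorem Nat.Partition.card_add_nonneg {n N : ℕ} (P : N.Partition) {m : ℤ}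
    (hn : (n : ℤ) = N + m + 1) (h : partitionRank P ≤ m + 2) : 0 ≤ P.parts.card + m + 1 := by
  rw [partitionRank] at h
  by_cases h0 : P.parts = 0
  · have := P.parts_sum
    rw [h0] at this h ⊢
    simp at this h ⊢
    omega
  · have := P.parts_pos (Multiset.sup_mem_of_ne_zero h0)
    omega

/-- The bijection behind Dyson's recursion for the number of partitions with given rank bounds. -/
def rankEquiv {n N : ℕ} {m : ℤ} (hn : (n : ℤ) = N + m + 1) :
    {P : n.Partition // m ≤ partitionRank P} ≃ {P : N.Partition // partitionRank P ≤ m + 2} where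
  toFun P := ⟨⟨stripMultiset m P.1.parts, by
      intro i hi
      obtain ⟨x, -, rfl⟩ := Multiset.mem_map.1 hi
      exact Nat.succ_pos x, by
      have := sum_stripMultiset (P.1.card_erase_sup_le hn P.2)
      have := P.1.parts_sum
      omega⟩, by
    have h := P.1.card_erase_sup_le hn P.2
    have h1 := card_stripMultiset h
    have h2 : (stripMultiset m P.1.parts).sup ≤ P.1.parts.sup + 1 := by
      rw [Multiset.sup_le]
      intro b hb
      obtain ⟨x, hx, rfl⟩ := Multiset.mem_map.1 hb
      rcases Multiset.mem_add.1 hx with hx | hx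
      · exact Nat.succ_le_succ (Multiset.le_sup (Multiset.mem_of_mem_erase hx))
      · rw [Multiset.eq_of_mem_replicate hx]
        omega
    rw [partitionRank]
    dsimp only
    omega⟩
  invFun P := ⟨⟨insertMultiset m P.1.parts, by
      intro i hi
      exact Nat.pos_of_ne_zero (Multiset.mem_filter.1 hi).2, by
      have := sum_insertMultiset (fun x hx => P.1.parts_pos hx) (P.1.card_add_nonneg hn P.2)
      have := P.1.parts_sum
      omega⟩, by
    have hc := P.1.card_add_nonneg hn P.2
    have hr : ∀ x ∈ P.1.parts, (x : ℤ) ≤ P.1.parts.card + m + 2 := fun x hx => by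
      linarith [P.1.rank_le_of_mem P.2 x hx]
    have h1 := sup_insertMultiset hr hc
    have h2 := erase_sup_insertMultiset hr hc
    have h3 : ((P.1.parts.map (· - 1)).filter (· ≠ 0)).card ≤ P.1.parts.card :=
      (Multiset.card_le_card (Multiset.filter_le _ _)).trans (Multiset.card_map _ _).le
    have h4 := congrArg Multiset.card h2
    rw [partitionRank]
    dsimp only
    by_cases h0 : insertMultiset m P.1.parts = 0
    · rw [h0] at h1 ⊢
      simp at h1 ⊢
      omega
    · have := Multiset.card_erase_add_one (Multiset.sup_mem_of_ne_zero h0)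
      omega⟩
  left_inv P := by
    apply Subtype.ext
    apply Nat.Partition.ext
    exact insertMultiset_stripMultiset (fun x hx => P.1.parts_pos hx)
      (P.1.card_erase_sup_le hn P.2)
  right_inv P := by
    apply Subtype.ext
    apply Nat.Partition.ext
    refine stripMultiset_insertMultiset (fun x hx => P.1.parts_pos hx) (fun x hx => ?_)
      (P.1.card_add_nonneg hn P.2)
    linarith [P.1.rank_le_of_mem P.2 x hx]

/-- The number of partitions of `n` whose rank is at least `m`. -/
def rankTail (m : ℤ) (n : ℕ) : ℕ := Fintype.card {P : n.Partition // m ≤ partitionRank P}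

theorem rankTail_add {n N : ℕ} {m : ℤ} (hn : (n : ℤ) = N + m + 1) :
    rankTail m n + rankTail (m + 3) N = Fintype.card N.Partition := by
  rw [rankTail, Fintype.card_congr (rankEquiv hn), rankTail, ← Fintype.card_subtype_or_disjoint,
    Fintype.card_subtype, ← Finset.card_univ]
  · congr 1
    exact Finset.filter_true_of_mem fun P _ => by omega
  · rw [Pi.disjoint_iff]
    intro P
    simp only [Prop.disjoint_iff]
    omega

theorem rankTail_le (m : ℤ) (n : ℕ) : rankTail m n ≤ Fintype.card n.Partition :=
  Fintype.card_subtype_le _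

theorem Nat.Partition.abs_rank_lt {n : ℕ} (hn : 0 < n) (P : n.Partition) :
    |partitionRank P| < n := by
  have h0 : P.parts ≠ 0 := by
    intro h
    have := P.parts_sum
    rw [h] at this
    simp at this
    omega
  have h1 := P.parts_pos (Multiset.sup_mem_of_ne_zero h0)
  have h2 := Multiset.card_pos.2 h0
  have h3 : P.parts.sup ≤ n := Multiset.sup_le.2 fun x hx => P.le_of_mem_parts hx
  have h4 : P.parts.card ≤ n := by
    have := sum_map_pred P.parts fun x hx => P.parts_pos hx
    rw [P.parts_sum] at this
    omega
  rw [partitionRank, abs_lt]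
  omega

theorem rankTail_eq_zero {m : ℤ} (hm : 1 ≤ m) {n : ℕ} (hn : (n : ℤ) ≤ m) : rankTail m n = 0 := by
  rw [rankTail, Fintype.card_eq_zero_iff]
  refine ⟨fun P => ?_⟩
  have h := P.2
  rcases Nat.eq_zero_or_pos n with rfl | h0
  · obtain ⟨P, hP⟩ := P
    rw [Subsingleton.elim P default] at hP
    simp [partitionRank] at hP
    omega
  · have := (abs_lt.1 (P.1.abs_rank_lt h0)).2
    omega

theorem rankTail_eq_card {m : ℤ} (hm : 1 ≤ m) {n : ℕ} (hn : (n : ℤ) ≤ m) :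
    rankTail (1 - m) n = Fintype.card n.Partition := by
  rw [rankTail, Fintype.card_subtype, ← Finset.card_univ]
  congr 1
  refine Finset.filter_true_of_mem fun P _ => ?_
  rcases Nat.eq_zero_or_pos n with rfl | h0
  · rw [Subsingleton.elim P default]
    simp [partitionRank]
    omega
  · have := (abs_lt.1 (P.abs_rank_lt h0)).1
    omega

theorem rankTail_add_rankTail_one_sub {m : ℤ} (hm : 1 ≤ m) (n : ℕ) :
    rankTail m n + rankTail (1 - m) n = Fintype.card n.Partition := by
  induction n using Nat.strong_induction_on generalizing m with
  | _ n ih =>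
    by_cases hn : (n : ℤ) ≤ m
    · rw [rankTail_eq_zero hm hn, rankTail_eq_card hm hn, zero_add]
    · obtain ⟨N, hN⟩ : ∃ N : ℕ, (n : ℤ) = N + m + 1 := ⟨(n - m - 1 : ℤ).toNat, by omega⟩
      have h1 := rankTail_add hN
      have h2 := rankTail_add (m := -m - 2) (n := N) (N := n) (by omega)
      have h3 := ih N (by omega) (show 1 ≤ m + 3 by omega)
      rw [show (1 : ℤ) - (m + 3) = -m - 2 by ring] at h3
      rw [show -m - 2 + 3 = 1 - m by ring] at h2
      omega

theorem card_partition_le_two_pow (n : ℕ) : Fintype.card n.Partition ≤ 2 ^ n := by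
  refine (Fintype.card_le_of_surjective _ Nat.Partition.ofComposition_surj).trans ?_
  rw [composition_card]
  exact Nat.pow_le_pow_right (by norm_num) (Nat.sub_le n 1)

theorem sum_ite_eq_add_seven_mul {n : ℕ} {a r : ℤ} (hr : r ≤ n) (ha : 0 ≤ a) :
    ∑ j ∈ Finset.range (n + 1), (if r = a + 7 * j then (1 : ℤ) else 0) =
      if a ≤ r ∧ r % 7 = a % 7 then 1 else 0 := by
  split_ifs with h
  · rw [Finset.sum_eq_single ((r - a) / 7).toNat]
    · rw [if_pos (by omega)]
    · intro j _ hj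
      rw [if_neg (by omega)]
    · intro hj
      rw [Finset.mem_range] at hj
      omega
  · refine Finset.sum_eq_zero fun j _ => ?_
    rw [if_neg (by omega)]

theorem rankTail_sub_rankTail (m : ℤ) (n : ℕ) :
    (rankTail m n : ℤ) - rankTail (m + 1) n =
      ∑ P : n.Partition, if partitionRank P = m then 1 else 0 := by
  simp only [rankTail, Fintype.card_subtype, Finset.card_filter, Nat.cast_sum,
    ← Finset.sum_sub_distrib]
  refine Finset.sum_congr rfl fun P _ => ?_
  push_cast
  split_ifs <;> omega

theorem rankCount_seven_eq_sum (n : ℕ) {a : ℤ} (ha : 0 ≤ a) (ha7 : a < 7) :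
    (rankCount a 7 n : ℤ) = ∑ j ∈ Finset.range (n + 1),
      (((rankTail (a + 7 * j) n : ℤ) - rankTail (a + 7 * j + 1) n) +
        ((rankTail (7 - a + 7 * j) n : ℤ) - rankTail (7 - a + 7 * j + 1) n)) := by
  have h : ∀ m : ℤ, 1 ≤ m → (rankTail m n : ℤ) - rankTail (m + 1) n =
      ∑ P : n.Partition, if -partitionRank P = m then 1 else 0 := by
    intro m hm
    have h1 := rankTail_add_rankTail_one_sub hm n
    have h2 := rankTail_add_rankTail_one_sub (m := m + 1) (by omega) n
    rw [show 1 - (m + 1) = -m by ring] at h2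
    rw [show ((rankTail m n : ℤ) - rankTail (m + 1) n) =
      rankTail (-m) n - rankTail (-m + 1) n by rw [show -m + 1 = 1 - m by ring]; omega,
      rankTail_sub_rankTail]
    refine Finset.sum_congr rfl fun P _ => ?_
    simp only [neg_eq_iff_eq_neg]
  have h2 : ∀ j : ℕ, (1 : ℤ) ≤ 7 - a + 7 * j := fun j => by omega
  simp only [h _ (h2 _), rankTail_sub_rankTail]
  rw [Finset.sum_add_distrib, Finset.sum_comm, Finset.sum_comm (s := Finset.range (n + 1)),
    ← Finset.sum_add_distrib, rankCount, Fintype.card_subtype, Finset.card_filter, Nat.cast_sum]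
  refine Finset.sum_congr rfl fun P _ => ?_
  have hP : partitionRank P ≤ n ∧ -partitionRank P ≤ n := by
    rcases Nat.eq_zero_or_pos n with rfl | h0
    · rw [Subsingleton.elim P default]
      simp [partitionRank]
    · have := abs_lt.1 (P.abs_rank_lt h0)
      omega
  rw [sum_ite_eq_add_seven_mul hP.1 ha, sum_ite_eq_add_seven_mul hP.2 (by omega)]
  push_cast
  split_ifs <;> omega

theorem two_mul_norm_sq_lt {s : ℂ} (hs3 : ‖s‖ < 1 / 3) : 2 * ‖s‖ ^ 2 ≤ 1 / 4 := by
  nlinarith [norm_nonneg s]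

theorem norm_coeff_mul_pow_le {s : ℂ} (hs3 : ‖s‖ < 1 / 3) {c : ℂ} {n : ℕ} (hc : ‖c‖ ≤ 2 ^ n) :
    ‖c * s ^ (2 * n)‖ ≤ (1 / 4) ^ n := by
  rw [norm_mul, norm_pow, pow_mul]
  calc ‖c‖ * (‖s‖ ^ 2) ^ n ≤ 2 ^ n * (‖s‖ ^ 2) ^ n := by gcongr
    _ = (2 * ‖s‖ ^ 2) ^ n := (mul_pow _ _ _).symm
    _ ≤ (1 / 4) ^ n := pow_le_pow_left₀ (by positivity) (two_mul_norm_sq_lt hs3) n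

theorem summable_coeff_mul_pow {s : ℂ} (hs3 : ‖s‖ < 1 / 3) {c : ℕ → ℂ}
    (hc : ∀ n, ‖c n‖ ≤ 2 ^ n) : Summable fun n => c n * s ^ (2 * n) :=
  .of_norm_bounded (summable_geometric_of_lt_one (by norm_num) (by norm_num : (1 / 4 : ℝ) < 1))
    fun n => norm_coeff_mul_pow_le hs3 (hc n)

theorem norm_rankTail_le (m : ℤ) (n : ℕ) : ‖(rankTail m n : ℂ)‖ ≤ 2 ^ n := by
  rw [Complex.norm_natCast]
  exact_mod_cast (rankTail_le m n).trans (card_partition_le_two_pow n)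

theorem norm_card_partition_le (n : ℕ) : ‖(Fintype.card n.Partition : ℂ)‖ ≤ 2 ^ n := by
  rw [Complex.norm_natCast]
  exact_mod_cast card_partition_le_two_pow n

/-- The generating function of partitions at `q = s ^ 2`. -/
noncomputable def partitionGen (s : ℂ) : ℂ :=
  ∑' n : ℕ, (Fintype.card n.Partition : ℂ) * s ^ (2 * n)

/-- The generating function of partitions of rank at least `m` at `q = s ^ 2`. -/
noncomputable def rankTailGen (s : ℂ) (m : ℕ) : ℂ := ∑' n : ℕ, (rankTail m n : ℂ) * s ^ (2 * n)

/-- The false theta series which is the ratio of `rankTailGen` and `partitionGen`. -/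
noncomputable def tailSeries (s : ℂ) (m : ℕ) : ℂ :=
  ∑' k : ℕ, (-1) ^ k * s ^ ((k + 1) * (3 * k + 2) + 2 * m * (k + 1))

theorem norm_rankTailGen_le {s : ℂ} (hs3 : ‖s‖ < 1 / 3) (m : ℕ) : ‖rankTailGen s m‖ ≤ 2 := by
  refine (tsum_of_norm_bounded (hasSum_geometric_of_lt_one (r := 1 / 4) (by norm_num) (by norm_num))
    fun n => norm_coeff_mul_pow_le hs3 (norm_rankTail_le m n)).trans (by norm_num)

theorem norm_tailSeries_term_le {s : ℂ} (hs3 : ‖s‖ < 1 / 3) {k e : ℕ} (he : k ≤ e) :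
    ‖(-1) ^ k * s ^ e‖ ≤ (1 / 2) ^ k := by
  rw [norm_mul, norm_pow, norm_neg, norm_one, one_pow, one_mul, norm_pow]
  calc ‖s‖ ^ e ≤ ‖s‖ ^ k := pow_le_pow_of_le_one (norm_nonneg _) (by linarith) he
    _ ≤ (1 / 2) ^ k := pow_le_pow_left₀ (norm_nonneg _) (by linarith) k

theorem summable_tailSeries {s : ℂ} (hs3 : ‖s‖ < 1 / 3) (m : ℕ) :
    Summable fun k : ℕ => (-1) ^ k * s ^ ((k + 1) * (3 * k + 2) + 2 * m * (k + 1)) :=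
  .of_norm_bounded (summable_geometric_of_lt_one (by norm_num) (by norm_num : (1 / 2 : ℝ) < 1))
    fun k => norm_tailSeries_term_le hs3 (by nlinarith [Nat.zero_le (m * (k + 1))])

theorem norm_tailSeries_le {s : ℂ} (hs3 : ‖s‖ < 1 / 3) (m : ℕ) : ‖tailSeries s m‖ ≤ 2 := by
  refine (tsum_of_norm_bounded (hasSum_geometric_of_lt_one (r := 1 / 2) (by norm_num) (by norm_num))
    fun k => norm_tailSeries_term_le hs3 (by nlinarith [Nat.zero_le (m * (k + 1))])).trans
      (by norm_num)

theorem tailSeries_eq {s : ℂ} (hs3 : ‖s‖ < 1 / 3) (m : ℕ) :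
    tailSeries s m = s ^ (2 * m + 2) * (1 - tailSeries s (m + 3)) := by
  rw [tailSeries, (summable_tailSeries hs3 m).tsum_eq_zero_add, tailSeries, mul_sub,
    ← tsum_mul_left, sub_eq_add_neg, ← tsum_neg]
  congr 1
  · ring
  · refine tsum_congr fun k => ?_
    ring

theorem rankTailGen_eq {s : ℂ} (hs3 : ‖s‖ < 1 / 3) (m : ℕ) :
    rankTailGen s m = (if m = 0 then 1 else 0) +
      s ^ (2 * m + 2) * (partitionGen s - rankTailGen s (m + 3)) := by
  have hT := fun m : ℤ => summable_coeff_mul_pow hs3 (norm_rankTail_le m)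
  have h0 : ∑ n ∈ Finset.range (m + 1), (rankTail m n : ℂ) * s ^ (2 * n) =
      if m = 0 then 1 else 0 := by
    split_ifs with hm
    · subst hm
      have := rankTail_eq_card (m := 1) le_rfl (n := 0) (by norm_num)
      norm_num at this
      simp [this]
    · refine Finset.sum_eq_zero fun n hn => ?_
      rw [Finset.mem_range] at hn
      rw [rankTail_eq_zero (by omega) (by omega)]
      simp
  rw [rankTailGen, ← (hT m).sum_add_tsum_nat_add (m + 1), h0, partitionGen, rankTailGen,
    ← (summable_coeff_mul_pow hs3 norm_card_partition_le).tsum_sub (hT (m + 3 : ℕ)),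
    ← tsum_mul_left]
  congr 1
  refine tsum_congr fun N => ?_
  rw [← rankTail_add (n := N + (m + 1)) (N := N) (m := m) (by push_cast; ring)]
  push_cast
  ring

theorem eq_zero_of_eq_neg_pow_mul {s : ℂ} (hs3 : ‖s‖ < 1 / 3) {δ : ℕ → ℂ} {B : ℝ}
    (hB : ∀ m, ‖δ m‖ ≤ B) (h : ∀ m, δ m = -s ^ (2 * m + 2) * δ (m + 3)) (m : ℕ) : δ m = 0 := by
  have h1 : ∀ k m, ‖δ m‖ ≤ (1 / 2) ^ k * B := by
    intro k
    induction k with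
    | zero => simpa using hB
    | succ k ih =>
      intro m
      have hB0 := (norm_nonneg _).trans (ih (m + 3))
      rw [h m, norm_mul, norm_neg, norm_pow, pow_succ' (1 / 2 : ℝ) k, mul_assoc]
      refine mul_le_mul ?_ (ih _) (norm_nonneg _) (by norm_num)
      calc ‖s‖ ^ (2 * m + 2) ≤ ‖s‖ ^ 1 :=
            pow_le_pow_of_le_one (norm_nonneg _) (by linarith) (by omega)
        _ ≤ 1 / 2 := by rw [pow_one]; linarith
  have h2 : Tendsto (fun k : ℕ => (1 / 2 : ℝ) ^ k * B) atTop (𝓝 (0 * B)) :=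
    (tendsto_pow_atTop_nhds_zero_of_lt_one (by norm_num) (by norm_num)).mul_const B
  rw [zero_mul] at h2
  exact norm_le_zero_iff.1 (ge_of_tendsto' h2 fun k => h1 k m)

theorem rankTailGen_eq_mul_tailSeries {s : ℂ} (hs3 : ‖s‖ < 1 / 3) {m : ℕ} :
    rankTailGen s m = (if m = 0 then 1 else 0) + partitionGen s * tailSeries s m := by
  have hB : ∀ m, ‖rankTailGen s m - (if m = 0 then 1 else 0) - partitionGen s * tailSeries s m‖ ≤
      3 + ‖partitionGen s‖ * 2 := by
    intro m
    have h1 : ‖(if m = 0 then 1 else 0 : ℂ)‖ ≤ 1 := by split_ifs <;> simp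
    have h2 := norm_rankTailGen_le hs3 m
    have h3 : ‖partitionGen s * tailSeries s m‖ ≤ ‖partitionGen s‖ * 2 := by
      rw [norm_mul]
      exact mul_le_mul_of_nonneg_left (norm_tailSeries_le hs3 m) (norm_nonneg _)
    linarith [norm_sub_le (rankTailGen s m - (if m = 0 then 1 else 0))
      (partitionGen s * tailSeries s m), norm_sub_le (rankTailGen s m) (if m = 0 then 1 else 0)]
  have h := eq_zero_of_eq_neg_pow_mul hs3 hB (fun m => by
    rw [tailSeries_eq hs3 m, rankTailGen_eq hs3 m, if_neg (Nat.succ_ne_zero (m + 2))]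
    ring) m
  linear_combination h

theorem rankTailGen_zero_add_one {s : ℂ} (hs3 : ‖s‖ < 1 / 3) :
    rankTailGen s 0 + rankTailGen s 1 = partitionGen s := by
  rw [rankTailGen, rankTailGen, partitionGen,
    ← (summable_coeff_mul_pow hs3 (norm_rankTail_le _)).tsum_add
      (summable_coeff_mul_pow hs3 (norm_rankTail_le _))]
  refine tsum_congr fun n => ?_
  have h := rankTail_add_rankTail_one_sub (m := 1) le_rfl n
  norm_num at h
  rw [← h]
  push_cast
  ring

theorem pent_eq {s : ℂ} (hs3 : ‖s‖ < 1 / 3) :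
    pent s = 1 - tailSeries s 0 - tailSeries s 1 := by
  have h1 : HasSum (fun n : ℕ => (-1) ^ ((n : ℤ) + 1) *
      s ^ (((n : ℤ) + 1) * (3 * ((n : ℤ) + 1) + 1))) (-tailSeries s 1) := by
    refine (summable_tailSeries hs3 1).hasSum.neg.congr_fun fun n => ?_
    rw [neg_one_zpow_succ, zpow_natCast, neg_mul, ← zpow_natCast s]
    push_cast
    ring_nf
  have h2 : HasSum (fun n : ℕ => (-1) ^ (-((n : ℤ) + 1)) *
      s ^ (-((n : ℤ) + 1) * (3 * -((n : ℤ) + 1) + 1))) (-tailSeries s 0) := by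
    refine (summable_tailSeries hs3 0).hasSum.neg.congr_fun fun n => ?_
    rw [neg_one_zpow_neg, neg_one_zpow_succ, zpow_natCast, neg_mul, ← zpow_natCast s]
    push_cast
    ring_nf
  rw [pent, (HasSum.of_add_one_of_neg_add_one (f := fun n : ℤ => (-1) ^ n * s ^ (n * (3 * n + 1)))
    h1 h2).tsum_eq]
  norm_num
  ring

theorem partitionGen_mul_pent {s : ℂ} (hs3 : ‖s‖ < 1 / 3) :
    partitionGen s * pent s = 1 := by
  have h := rankTailGen_zero_add_one hs3
  rw [rankTailGen_eq_mul_tailSeries hs3, rankTailGen_eq_mul_tailSeries hs3] at h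
  rw [pent_eq hs3]
  norm_num at h
  linear_combination -h

/-- The sum of the series `tailSeries` along an arithmetic progression modulo seven. -/
noncomputable def tailSum (s : ℂ) (m : ℕ) : ℂ :=
  ∑' k : ℕ, (-1) ^ k * s ^ ((k + 1) * (3 * k + 2) + 2 * m * (k + 1)) / (1 - s ^ (14 * (k + 1)))

theorem hasSum_tailSeries {s : ℂ} (hs3 : ‖s‖ < 1 / 3) (m : ℕ) :
    HasSum (fun j : ℕ => tailSeries s (m + 7 * j)) (tailSum s m) := by
  have hg := summable_geometric_of_lt_one (by norm_num) (by norm_num : (1 / 2 : ℝ) < 1)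
  have hF : Summable fun p : ℕ × ℕ => (-1) ^ p.1 *
      s ^ ((p.1 + 1) * (3 * p.1 + 2) + 2 * (m + 7 * p.2) * (p.1 + 1)) := by
    refine .of_norm_bounded (hg.mul_of_nonneg hg (fun _ => by positivity) fun _ => by positivity)
      fun p => ?_
    rw [norm_mul, norm_pow, norm_neg, norm_one, one_pow, one_mul, norm_pow, ← pow_add]
    calc ‖s‖ ^ _ ≤ ‖s‖ ^ (p.1 + p.2) :=
          pow_le_pow_of_le_one (norm_nonneg _) (by linarith) (by
            nlinarith [Nat.zero_le (m * (p.1 + 1)), Nat.zero_le (p.2 * p.1)])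
      _ ≤ (1 / 2) ^ (p.1 + p.2) := pow_le_pow_left₀ (norm_nonneg _) (by linarith) _
  have h := ((Equiv.prodComm ℕ ℕ).hasSum_iff.2 hF.hasSum).prod_fiberwise fun j =>
    (summable_tailSeries hs3 (m + 7 * j)).hasSum
  suffices hv : tailSum s m = _ by
    rw [hv]
    exact h
  rw [tailSum, hF.tsum_prod]
  refine tsum_congr fun k => ?_
  have hk : ‖s ^ (14 * (k + 1))‖ < 1 := by
    rw [norm_pow]
    exact pow_lt_one₀ (norm_nonneg _) (by linarith) (by omega)
  rw [div_eq_mul_inv, ← tsum_geometric_of_norm_lt_one hk, ← tsum_mul_left]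
  refine tsum_congr fun j => ?_
  rw [← pow_mul, mul_assoc, ← pow_add]
  ring_nf

theorem tsum_int_eq_add_one {F : ℤ → ℂ} (hF : Summable F) :
    ∑' n, F n = ∑' n : ℕ, F ((n : ℤ) + 1) + F 0 + ∑' n : ℕ, F (-((n : ℤ) + 1)) :=
  tsum_of_add_one_of_neg_add_one
    (hF.comp_injective (i := fun n : ℕ => (n : ℤ) + 1) fun a b h => by simpa using h)
    (hF.comp_injective (i := fun n : ℕ => -((n : ℤ) + 1)) fun a b h => by simpa using h)

theorem rankSeries_eq_tailSum {s : ℂ} (hs : s ≠ 0) (hs3 : ‖s‖ < 1 / 3) {m m' : ℕ}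
    (hm : m + m' = 8) : rankSeries s (m - 1) = tailSum s m' - tailSum s m := by
  have hS := summable_rankSeries hs hs3 (m - 1)
  have hne : ∀ k : ℕ, 1 - s ^ (14 * (k + 1)) ≠ 0 := fun k h => by
    have := congrArg norm (sub_eq_zero.1 h)
    rw [norm_one, norm_pow] at this
    exact absurd this.symm (pow_lt_one₀ (norm_nonneg _) (by linarith) (by omega)).ne
  have h1 : ∑' n : ℕ, (-1) ^ ((n : ℤ) + 1) * s ^ (((n : ℤ) + 1) * (3 * ((n : ℤ) + 1) + 1) +
      2 * ((m : ℤ) - 1) * ((n : ℤ) + 1)) / (1 - s ^ (14 * ((n : ℤ) + 1))) = -tailSum s m := by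
    rw [tailSum, ← tsum_neg]
    refine tsum_congr fun n => ?_
    rw [neg_one_zpow_succ, zpow_natCast, ← zpow_natCast s, ← zpow_natCast s, neg_mul, neg_div]
    push_cast
    ring_nf
  have h2 : ∑' n : ℕ, (-1) ^ (-((n : ℤ) + 1)) * s ^ (-((n : ℤ) + 1) * (3 * -((n : ℤ) + 1) + 1) +
      2 * ((m : ℤ) - 1) * -((n : ℤ) + 1)) / (1 - s ^ (14 * -((n : ℤ) + 1))) = tailSum s m' := by
    rw [tailSum]
    refine tsum_congr fun n => ?_
    have e1 : s ^ (14 * -((n : ℤ) + 1)) = (s ^ (14 * (n + 1)))⁻¹ := by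
      rw [← zpow_natCast, ← zpow_neg]
      push_cast
      ring_nf
    have e2 : s ^ ((n + 1) * (3 * n + 2) + 2 * m' * (n + 1)) =
        s ^ (-((n : ℤ) + 1) * (3 * -((n : ℤ) + 1) + 1) + 2 * ((m : ℤ) - 1) * -((n : ℤ) + 1)) *
          s ^ (14 * (n + 1)) := by
      rw [← zpow_natCast, ← zpow_natCast, ← zpow_add₀ hs]
      congr 1
      push_cast
      have : (m' : ℤ) = 8 - m := by omega
      rw [this]
      ring
    have hX : s ^ (14 * (n + 1)) ≠ 0 := pow_ne_zero _ hs
    have hne' := hne n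
    rw [e1, e2, neg_one_zpow_neg, neg_one_zpow_succ, zpow_natCast]
    generalize s ^ (14 * (n + 1)) = x at *
    have : 1 - x⁻¹ = -(1 - x) * x⁻¹ := by field_simp; ring
    rw [this]
    field_simp
  rw [rankSeries, tsum_int_eq_add_one hS, h1, h2, mul_zero 14, zpow_zero s, sub_self, div_zero]
  ring

theorem hasSum_rankTail {s : ℂ} (hs3 : ‖s‖ < 1 / 3) (m : ℕ) :
    HasSum (fun n : ℕ => (∑ j ∈ Finset.range (n + 1), (rankTail (m + 7 * j : ℕ) n : ℂ)) *
      s ^ (2 * n)) ((if m = 0 then 1 else 0) + partitionGen s * tailSum s m) := by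
  have hg := summable_geometric_of_lt_one (by norm_num) (by norm_num : (1 / 2 : ℝ) < 1)
  have hz : ∀ n j : ℕ, n < j → rankTail (m + 7 * j : ℕ) n = 0 := fun n j h =>
    rankTail_eq_zero (by push_cast; omega) (by push_cast; omega)
  have hF : Summable fun p : ℕ × ℕ => (rankTail (m + 7 * p.1 : ℕ) p.2 : ℂ) * s ^ (2 * p.2) := by
    refine .of_norm_bounded (hg.mul_of_nonneg hg (fun _ => by positivity) fun _ => by positivity)
      fun p => ?_
    by_cases h : p.2 < p.1
    · rw [hz _ _ h]
      simp
    · calc _ ≤ (1 / 4 : ℝ) ^ p.2 := norm_coeff_mul_pow_le hs3 (norm_rankTail_le _ _)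
        _ = (1 / 2) ^ p.2 * (1 / 2) ^ p.2 := by rw [← mul_pow]; norm_num
        _ ≤ (1 / 2) ^ p.1 * (1 / 2) ^ p.2 := by
          gcongr ?_ * _
          exact pow_le_pow_of_le_one (by norm_num) (by norm_num) (not_lt.1 h)
  have h1 : HasSum (fun j : ℕ => rankTailGen s (m + 7 * j))
      ((if m = 0 then 1 else 0) + partitionGen s * tailSum s m) := by
    have h := (hasSum_ite_eq (0 : ℕ) (if m = 0 then 1 else 0 : ℂ)).add
      ((hasSum_tailSeries hs3 m).mul_left (partitionGen s))
    convert h using 2 with j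
    rw [rankTailGen_eq_mul_tailSeries hs3]
    congr 1
    split_ifs <;> first | rfl | omega
  have h2 := hF.hasSum.prod_fiberwise fun j =>
    (summable_coeff_mul_pow hs3 (norm_rankTail_le (m + 7 * j : ℕ))).hasSum
  have h3 := h2.unique h1
  rw [← h3]
  refine ((Equiv.prodComm ℕ ℕ).hasSum_iff.2 hF.hasSum).prod_fiberwise fun n => ?_
  rw [Finset.sum_mul]
  refine hasSum_sum_of_ne_finset_zero fun j hj => ?_
  rw [Finset.mem_range] at hj
  change (rankTail (m + 7 * j : ℕ) n : ℂ) * s ^ (2 * n) = 0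
  rw [hz n j (by omega), Nat.cast_zero, zero_mul]

theorem hasSum_rankCount {s : ℂ} (hs : s ≠ 0) (hs3 : ‖s‖ < 1 / 3) {a : ℕ} (ha : a < 7) :
    HasSum (fun n : ℕ => (rankCount a 7 n : ℂ) * s ^ (2 * n)) ((if a = 0 then 1 else 0) +
      partitionGen s * (rankSeries s a - rankSeries s (a - 1))) := by
  obtain ⟨b, hb⟩ : ∃ b, a + b = 7 := ⟨7 - a, by omega⟩
  have h := (((hasSum_rankTail hs3 a).sub (hasSum_rankTail hs3 (a + 1))).add
    (hasSum_rankTail hs3 b)).sub (hasSum_rankTail hs3 (b + 1))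
  have h1 := rankSeries_eq_tailSum hs hs3 (m := a + 1) (m' := b) (by omega)
  have h2 := rankSeries_eq_tailSum hs hs3 (m := a) (m' := b + 1) (by omega)
  rw [Nat.cast_add, Nat.cast_one, add_sub_cancel_right] at h1
  rw [if_neg (Nat.succ_ne_zero a), if_neg (Nat.succ_ne_zero b), if_neg (by omega : b ≠ 0)] at h
  suffices hv : (if a = 0 then 1 else 0) +
      partitionGen s * (rankSeries s a - rankSeries s (a - 1)) = _ by
    rw [hv]
    refine h.congr_fun fun n => ?_
    have e := congrArg (Int.cast : ℤ → ℂ) (rankCount_seven_eq_sum n (a := a) (by omega) (by omega))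
    have hb' : (b : ℤ) = 7 - a := by omega
    push_cast at e
    rw [e, ← sub_mul, ← add_mul, ← sub_mul, ← Finset.sum_sub_distrib, ← Finset.sum_add_distrib,
      ← Finset.sum_sub_distrib]
    congr 1
    refine Finset.sum_congr rfl fun j _ => ?_
    push_cast
    rw [hb', show (a : ℤ) + 1 + 7 * j = a + 7 * j + 1 by ring,
      show 7 - (a : ℤ) + 1 + 7 * j = 7 - a + 7 * j + 1 by ring]
    ring
  rw [h1, h2]
  ring

/-- Averaging over seventh roots of unity shows no power of `s ^ 2` with exponent `5` modulo `7`. -/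
def Lacunary (G : ℂ → ℂ) : Prop :=
  ∀ ζ : ℂ, IsPrimitiveRoot ζ 7 → ∀ s, s ≠ 0 → ‖s‖ < 1 / 3 →
    ∑ j ∈ Finset.range 7, (ζ ^ 4) ^ j * G (ζ ^ j * s) = 0

theorem Lacunary.add {G H : ℂ → ℂ} (hG : Lacunary G) (hH : Lacunary H) :
    Lacunary fun s => G s + H s := by
  intro ζ hζ s hs hs3
  simp only [mul_add, Finset.sum_add_distrib, hG ζ hζ s hs hs3, hH ζ hζ s hs hs3, add_zero]

theorem Lacunary.const_mul {G : ℂ → ℂ} (hG : Lacunary G) (c : ℂ) : Lacunary fun s => c * G s := by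
  intro ζ hζ s hs hs3
  simp only [mul_left_comm _ c, ← Finset.mul_sum, hG ζ hζ s hs hs3, mul_zero]

theorem Lacunary.congr {G H : ℂ → ℂ} (hG : Lacunary G)
    (h : ∀ s, s ≠ 0 → ‖s‖ < 1 / 3 → H s = G s) : Lacunary H := by
  intro ζ hζ s hs hs3
  rw [← hG ζ hζ s hs hs3]
  refine Finset.sum_congr rfl fun j _ => ?_
  rw [h _ (mul_ne_zero (pow_ne_zero j (hζ.ne_zero (by norm_num))) hs)]
  rwa [norm_mul, norm_pow, hζ.norm'_eq_one (by norm_num), one_pow, one_mul]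

theorem sum_pow_primitiveRoot_seven {ζ : ℂ} (hζ : IsPrimitiveRoot ζ 7) (e : ℕ) :
    ∑ j ∈ Finset.range 7, (ζ ^ e) ^ j = if 7 ∣ e then 7 else 0 := by
  split_ifs with h
  · rw [(hζ.pow_eq_one_iff_dvd e).2 h]
    simp
  · have h1 : ζ ^ e - 1 ≠ 0 := sub_ne_zero.2 fun h1 => h ((hζ.pow_eq_one_iff_dvd e).1 h1)
    have h2 := geom_sum_mul (ζ ^ e) 7
    rw [← pow_mul, mul_comm e, pow_mul, hζ.pow_eq_one, one_pow, sub_self] at h2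
    exact (mul_eq_zero.1 h2).resolve_right h1

theorem lacunary_pow_mul {e : ℕ} (he : e % 7 ≠ 5) (W : ℂ → ℂ) :
    Lacunary fun s => s ^ (2 * e) * W (s ^ 7) := by
  intro ζ hζ s _ _
  have h : ∀ j, (ζ ^ 4) ^ j * ((ζ ^ j * s) ^ (2 * e) * W ((ζ ^ j * s) ^ 7)) =
      (ζ ^ (4 + 2 * e)) ^ j * (s ^ (2 * e) * W (s ^ 7)) := by
    intro j
    rw [mul_pow _ _ 7, ← pow_mul ζ j 7, mul_comm j 7, pow_mul ζ 7, hζ.pow_eq_one, one_pow, one_mul]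
    ring
  simp only [h, ← Finset.sum_mul, sum_pow_primitiveRoot_seven hζ]
  rw [if_neg (by omega), zero_mul]

theorem lacunary_thetaPart (W : ℂ → ℂ) (f0 f1 f3 f4 : ℂ) :
    Lacunary fun s => W (s ^ 7) * thetaPart s f0 f1 f3 f4 := by
  have h0 := lacunary_pow_mul (e := 0) (by norm_num) fun x => W x * -deriv (jac (x ^ 7)) 1 *
    (theta7 x 3 / (theta7 x 1 * theta7 x 2))
  have h1 := lacunary_pow_mul (e := 1) (by norm_num) fun x => W x * -deriv (jac (x ^ 7)) 1 *
    (1 / theta7 x 1)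
  have h2 := lacunary_pow_mul (e := 2) (by norm_num) fun x => W x * -deriv (jac (x ^ 7)) 1 *
    (theta7 x 2 / (theta7 x 1 * theta7 x 3))
  have h3 := lacunary_pow_mul (e := 3) (by norm_num) fun x => W x * -deriv (jac (x ^ 7)) 1 *
    (1 / theta7 x 2)
  have h4 := lacunary_pow_mul (e := 4) (by norm_num) fun x => W x * -deriv (jac (x ^ 7)) 1 *
    (1 / theta7 x 3)
  have h6 := lacunary_pow_mul (e := 6) (by norm_num) fun x => W x * -deriv (jac (x ^ 7)) 1 *
    (theta7 x 1 / (theta7 x 2 * theta7 x 3))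
  refine ((((((h0.const_mul f0).add (h1.const_mul f1)).add (h2.const_mul (f0 + f1))).add
    (h3.const_mul f3)).add (h4.const_mul f4)).add (h6.const_mul (f0 + f3))).congr fun s _ _ => ?_
  rw [thetaPart]
  ring

theorem eq_zero_of_hasSum_zero {d : ℕ → ℤ} (hd : ∀ n, |d n| ≤ 2 ^ n)
    (h : ∀ s : ℂ, s ≠ 0 → ‖s‖ < 1 / 3 → HasSum (fun n => (d n : ℂ) * s ^ (2 * n)) 0) (n : ℕ) :
    d n = 0 := by
  induction n using Nat.strong_induction_on with
  | _ N ih =>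
    by_contra hN
    have hs : ((1 / 2 : ℂ) ^ (N + 2)) ≠ 0 := pow_ne_zero _ (by norm_num)
    have hn : ‖(1 / 2 : ℂ) ^ (N + 2)‖ = (1 / 2) ^ (N + 2) := by simp
    have hlt : (1 / 2 : ℝ) ^ (N + 2) ≤ 1 / 4 := by
      rw [pow_add]
      have : (1 / 2 : ℝ) ^ N ≤ 1 := pow_le_one₀ (by norm_num) (by norm_num)
      linarith
    have h1 := h _ hs (by rw [hn]; linarith)
    generalize (1 / 2 : ℂ) ^ (N + 2) = s at *
    rw [← hasSum_nat_add_iff' (N + 1), Finset.sum_range_succ, Finset.sum_eq_zero, zero_add,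
      zero_sub] at h1
    swap
    · intro i hi
      rw [ih i (Finset.mem_range.1 hi)]
      simp
    have hx : 2 * ‖s‖ ^ 2 ≤ 1 / 2 * ‖s‖ := by
      rw [hn]
      nlinarith [pow_pos (by norm_num : (0 : ℝ) < 1 / 2) (N + 2)]
    have h2 := tsum_of_norm_bounded (f := fun k => (d (k + (N + 1)) : ℂ) * s ^ (2 * (k + (N + 1))))
      ((hasSum_geometric_of_lt_one (r := 1 / 2) (by norm_num) (by norm_num)).mul_left
        (‖s‖ ^ (2 * N) * (1 / 8))) fun k => ?_
    · rw [h1.tsum_eq, norm_neg, norm_mul, norm_pow] at h2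
      have h3 : 1 ≤ ‖(d N : ℂ)‖ := by
        rw [Complex.norm_intCast]
        exact_mod_cast Int.one_le_abs hN
      have h4 : 0 < ‖s‖ ^ (2 * N) := pow_pos (norm_pos_iff.2 hs) _
      rw [(by norm_num : (1 - 1 / 2 : ℝ)⁻¹ = 2)] at h2
      nlinarith
    · have h3 : ‖(d (k + (N + 1)) : ℂ)‖ ≤ 2 ^ (k + (N + 1)) := by
        rw [Complex.norm_intCast]
        exact_mod_cast hd _
      rw [norm_mul, norm_pow]
      have h4 : (2 : ℝ) ^ N * ‖s‖ = 1 / 4 := by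
        rw [hn, pow_add, ← mul_assoc, ← mul_pow]
        norm_num
      calc ‖(d (k + (N + 1)) : ℂ)‖ * ‖s‖ ^ (2 * (k + (N + 1)))
          ≤ 2 ^ (k + (N + 1)) * ‖s‖ ^ (2 * (k + (N + 1))) := by gcongr
        _ = ‖s‖ ^ (2 * N) * (2 ^ N * (2 * ‖s‖ ^ 2)) * (2 * ‖s‖ ^ 2) ^ k := by ring
        _ ≤ ‖s‖ ^ (2 * N) * (1 / 8) * (1 / 2) ^ k := by
          gcongr
          · nlinarith [pow_pos (by norm_num : (0 : ℝ) < 2) N]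
          · rw [hn] at hx ⊢
            linarith

theorem coeff_eq_zero_of_lacunary {d : ℕ → ℤ} (hd : ∀ n, |d n| ≤ 2 ^ n) {G : ℂ → ℂ}
    (hG : Lacunary G)
    (h : ∀ s : ℂ, s ≠ 0 → ‖s‖ < 1 / 3 → HasSum (fun n => (d n : ℂ) * s ^ (2 * n)) (G s)) (n : ℕ) :
    d (7 * n + 5) = 0 := by
  have hζ := Complex.isPrimitiveRoot_exp 7 (by norm_num)
  generalize Complex.exp _ = ζ at hζ
  have key := eq_zero_of_hasSum_zero (d := fun n => if n % 7 = 5 then d n else 0)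
    (fun n => by
      split_ifs
      · exact hd n
      · rw [abs_zero]; positivity)
    (fun s hs hs3 => ?_) (7 * n + 5)
  · simpa [Nat.add_mod] using key
  · have hj : ∀ j ∈ Finset.range 7, HasSum
        (fun n => (ζ ^ 4) ^ j * ((d n : ℂ) * (ζ ^ j * s) ^ (2 * n)))
        ((ζ ^ 4) ^ j * G (ζ ^ j * s)) :=
      fun j _ => (h _ (mul_ne_zero (pow_ne_zero j (hζ.ne_zero (by norm_num))) hs) (by
        rwa [norm_mul, norm_pow, hζ.norm'_eq_one (by norm_num), one_pow, one_mul])).mul_left _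
    have hS := (hasSum_sum hj).mul_left (1 / 7)
    rw [hG ζ hζ s hs hs3, mul_zero] at hS
    refine hS.congr_fun fun n => ?_
    have e : ∀ j, (ζ ^ 4) ^ j * ((d n : ℂ) * (ζ ^ j * s) ^ (2 * n)) =
        (ζ ^ (4 + 2 * n)) ^ j * ((d n : ℂ) * s ^ (2 * n)) := fun j => by ring
    simp only [e, ← Finset.sum_mul, sum_pow_primitiveRoot_seven hζ]
    split_ifs <;> first | omega | (push_cast; ring)

theorem rankCount_le_two_pow (a b : ℤ) (n : ℕ) : rankCount a b n ≤ 2 ^ n :=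
  (Fintype.card_subtype_le _).trans (card_partition_le_two_pow n)

theorem lacunary_lerch7_add_thetaPart (c c1 c2 c3 : ℂ) :
    Lacunary fun s => c + (c1 * (7 * s ^ 14 * lerch7 (s ^ 7) 0 1 + thetaPart s (-4) 3 2 1) +
      c2 * (-7 * s ^ 26 * lerch7 (s ^ 7) 0 2 + thetaPart s (-1) (-1) (-3) 2) +
      c3 * (7 * s ^ 32 * lerch7 (s ^ 7) 0 3 + thetaPart s 2 2 (-1) 3)) / pent ((s ^ 7) ^ 7) := by
  have h0 := lacunary_pow_mul (e := 0) (by norm_num) fun _ => c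
  have l1 := lacunary_pow_mul (e := 7) (by norm_num) fun x => (pent (x ^ 7))⁻¹ * lerch7 x 0 1
  have l2 := lacunary_pow_mul (e := 13) (by norm_num) fun x => (pent (x ^ 7))⁻¹ * lerch7 x 0 2
  have l3 := lacunary_pow_mul (e := 16) (by norm_num) fun x => (pent (x ^ 7))⁻¹ * lerch7 x 0 3
  have t := lacunary_thetaPart fun x => (pent (x ^ 7))⁻¹
  refine ((((h0.add (l1.const_mul (7 * c1))).add ((t (-4) 3 2 1).const_mul c1)).add
    ((l2.const_mul (-7 * c2)).add ((t (-1) (-1) (-3) 2).const_mul c2))).add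
    ((l3.const_mul (7 * c3)).add ((t 2 2 (-1) 3).const_mul c3))).congr fun s _ _ => ?_
  ring

theorem rankCount_eq_of_lacunary {a b : ℕ} {G : ℂ → ℂ} (hG : Lacunary G)
    (h : ∀ s : ℂ, s ≠ 0 → ‖s‖ < 1 / 3 →
      HasSum (fun n => ((rankCount a 7 n : ℂ) - rankCount b 7 n) * s ^ (2 * n)) (G s)) (n : ℕ) :
    rankCount a 7 (7 * n + 5) = rankCount b 7 (7 * n + 5) := by
  have key := coeff_eq_zero_of_lacunary (d := fun n => (rankCount a 7 n : ℤ) - rankCount b 7 n)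
    (fun n => by
      have h1 : (rankCount a 7 n : ℤ) ≤ 2 ^ n := mod_cast rankCount_le_two_pow a 7 n
      have h2 : (rankCount b 7 n : ℤ) ≤ 2 ^ n := mod_cast rankCount_le_two_pow b 7 n
      rw [abs_le]
      constructor <;> linarith [(rankCount a 7 n).cast_nonneg (α := ℤ),
        (rankCount b 7 n).cast_nonneg (α := ℤ)])
    hG (fun s hs hs3 => by simpa using h s hs hs3) n
  exact_mod_cast sub_eq_zero.1 key

theorem hasSum_rankCount_sub {s : ℂ} (hs : s ≠ 0) (hs3 : ‖s‖ < 1 / 3) {a b : ℕ} (ha : a < 7)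
    (hb : b < 7) {z : ℂ} (hz : (if a = 0 then 1 else 0) - (if b = 0 then 1 else 0) +
      partitionGen s * (rankSeries s a - rankSeries s (a - 1) -
        (rankSeries s b - rankSeries s (b - 1))) = z) :
    HasSum (fun n : ℕ => ((rankCount a 7 n : ℂ) - rankCount b 7 n) * s ^ (2 * n)) z := by
  have h := (hasSum_rankCount hs hs3 ha).sub (hasSum_rankCount hs hs3 hb)
  rw [add_sub_add_comm, ← mul_sub, hz] at h
  exact h.congr_fun fun n => sub_mul _ _ _

theorem rankSeries_relations {s : ℂ} (hs : s ≠ 0) (hs3 : ‖s‖ < 1 / 3) :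
    rankSeries s (-1) = pent s - 1 - rankSeries s 0 ∧ rankSeries s 2 = -rankSeries s 4 ∧
      rankSeries s 3 = 0 := by
  have h1 := rankSeries_six_sub hs 7
  have h2 := rankSeries_six_sub hs 4
  have h3 := rankSeries_six_sub hs 3
  norm_num at h1 h2 h3
  refine ⟨?_, h2, self_eq_neg.1 h3⟩
  linear_combination h1 + rankSeries_sub_add_seven hs hs3

theorem dyson_7_5 (n : ℕ) :
    rankCount 0 7 (7 * n + 5) = rankCount 1 7 (7 * n + 5) ∧
    rankCount 1 7 (7 * n + 5) = rankCount 2 7 (7 * n + 5) ∧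
    rankCount 2 7 (7 * n + 5) = rankCount 3 7 (7 * n + 5) := by
  refine ⟨rankCount_eq_of_lacunary (lacunary_lerch7_add_thetaPart 3 (3 / 7) 0 (-1 / 7))
      (fun s hs hs3 => hasSum_rankCount_sub hs hs3 (a := 0) (b := 1) (by norm_num)
        (by norm_num) ?_) n,
    rankCount_eq_of_lacunary (lacunary_lerch7_add_thetaPart (-1) (-1 / 7) (1 / 7) (2 / 7))
      (fun s hs hs3 => hasSum_rankCount_sub hs hs3 (a := 1) (b := 2) (by norm_num)
        (by norm_num) ?_) n,
    rankCount_eq_of_lacunary (lacunary_lerch7_add_thetaPart 0 0 (-2 / 7) (-1 / 7))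
      (fun s hs hs3 => hasSum_rankCount_sub hs hs3 (a := 2) (b := 3) (by norm_num)
        (by norm_num) ?_) n⟩
  all_goals
    obtain ⟨r1, r2, r3⟩ := rankSeries_relations hs hs3
    have h0 := rankSeries_sub_add_seven hs hs3
    have h7 := rankSeries_seven hs hs3
    have h4 := rankSeries_four hs hs3
    have h1 := rankSeries_one hs hs3
    have hP := partitionGen_mul_pent hs3
    have e : ∀ {x B : ℂ}, x = pent s / pent ((s ^ 7) ^ 7) * B →
        B / pent ((s ^ 7) ^ 7) = partitionGen s * x := fun {x B} h => by
      rw [h, ← mul_assoc, ← mul_div_assoc, hP, one_div_mul_eq_div]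
    rw [add_div, add_div, mul_div_assoc, mul_div_assoc, mul_div_assoc, e h7, e h4, e h1]
    norm_num [r1, r2, r3]
  · linear_combination 3 * partitionGen s * h0 + 2 * hP
  · linear_combination -partitionGen s * h0 - hP
  · ring
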